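/- arXiv:1805.11442 — 13 statements merged into one kernel-verified Lean document; each statement's English description precedes it below -/
import Mathlib

section
/- If a, b, c are the side lengths of a spherical triangle, then sin(a/2) < sin(b/2) + sin(c/2), sin(b/2) < sin(a/2) + sin(c/2), and sin(c/2) < sin(a/2) + sin(b/2); that is, there exists a Euclidean triangle with side lengths sin(a/2), sin(b/2), sin(c/2). -/
/-- If `0 < x`, `|y - z| < x < y + z` and `x + y + z < 2π`, then
`sin (x/2) < sin (y/2) + sin (z/2)`. -/
theorem sin_half_lt_sin_half_add_sin_half {x y z : ℝ} (hx : 0 < x) (hxyz : x < y + z)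
    (hyxz : y < x + z) (hzxy : z < x + y) (hsum : x + y + z < 2 * Real.pi) :
    Real.sin (x / 2) < Real.sin (y / 2) + Real.sin (z / 2) := by
  have hsin : Real.sin (x / 4) < Real.sin ((y + z) / 4) :=
    Real.sin_lt_sin_of_lt_of_le_pi_div_two (by linarith) (by linarith) (by linarith)
  have hcos : Real.cos (x / 4) < Real.cos ((y - z) / 4) := by
    rw [← Real.cos_abs ((y - z) / 4)]
    exact Real.cos_lt_cos_of_nonneg_of_le_pi (abs_nonneg _) (by linarith)
      (abs_lt.2 ⟨by linarith, by linarith⟩)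
  have hsin_pos : 0 < Real.sin (x / 4) := Real.sin_pos_of_pos_of_lt_pi (by linarith) (by linarith)
  have hcos_pos : 0 < Real.cos (x / 4) :=
    Real.cos_pos_of_mem_Ioo ⟨by linarith, by linarith⟩
  have hdouble : Real.sin (x / 2) = 2 * (Real.sin (x / 4) * Real.cos (x / 4)) := by
    rw [← mul_assoc, ← Real.sin_two_mul]
    ring_nf
  have hadd : Real.sin (y / 2) + Real.sin (z / 2) =
      2 * (Real.sin ((y + z) / 4) * Real.cos ((y - z) / 4)) := by
    rw [show y / 2 = (y + z) / 4 + (y - z) / 4 by ring,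
      show z / 2 = (y + z) / 4 - (y - z) / 4 by ring, Real.sin_add, Real.sin_sub]
    ring
  rw [hdouble, hadd]
  gcongr

/-- If `a`, `b`, `c` are the side lengths of a spherical triangle (on the unit sphere),
then `sin (a/2)`, `sin (b/2)`, `sin (c/2)` satisfy the strict triangle inequalities,
i.e. there exists a Euclidean triangle with these side lengths. -/
theorem spherical_s_triangle (a b c : ℝ)
    (ha : 0 < a) (hb : 0 < b) (hc : 0 < c)
    (habc : a < b + c) (hbac : b < a + c) (hcab : c < a + b)
    (hsum : a + b + c < 2 * Real.pi) :
    Real.sin (a / 2) < Real.sin (b / 2) + Real.sin (c / 2) ∧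
    Real.sin (b / 2) < Real.sin (a / 2) + Real.sin (c / 2) ∧
    Real.sin (c / 2) < Real.sin (a / 2) + Real.sin (b / 2) := by
  exact ⟨sin_half_lt_sin_half_add_sin_half ha habc hbac hcab hsum,
    sin_half_lt_sin_half_add_sin_half hb hbac habc (by linarith) (by linarith),
    sin_half_lt_sin_half_add_sin_half hc hcab (by linarith) (by linarith) (by linarith)⟩
end

section
/- If a, b, c are the side lengths of a spherical triangle, then J ≤ J̄, with equality if and only if a = b = c. -/
/-- The defect between `sin (p - q) ^ 2` and `(sin p - sin q) ^ 2`, in product form. -/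
theorem sin_sub_sq_sub_sub_sin_sq (p q : ℝ) :
    Real.sin (p - q) ^ 2 - (Real.sin p - Real.sin q) ^ 2 =
      4 * Real.sin ((p - q) / 2) ^ 2 * (Real.sin p * Real.sin q) := by
  have h : Real.sin ((p - q) / 2) ^ 2 = (1 - Real.cos (p - q)) / 2 := by
    rw [Real.sin_sq_eq_half_sub, mul_div_cancel₀ _ two_ne_zero]
    ring
  rw [h, Real.sin_sq (p - q), Real.cos_sub]
  linear_combination (-Real.cos q ^ 2) * Real.sin_sq_add_cos_sq p
    - (1 - Real.sin p ^ 2) * Real.sin_sq_add_cos_sq q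

/-- `sin (r + t) * sin (r - t)` as a difference of squares. -/
theorem sin_add_mul_sin_sub (r t : ℝ) :
    Real.sin (r + t) * Real.sin (r - t) = Real.sin r ^ 2 - Real.sin t ^ 2 := by
  rw [Real.sin_add, Real.sin_sub]
  linear_combination Real.sin r ^ 2 * Real.sin_sq_add_cos_sq t
    - Real.sin t ^ 2 * Real.sin_sq_add_cos_sq r

/-- The comparison for two of the three factors of `J` and `J̄`. -/
theorem spherical_pair_le {a b c : ℝ} (hb : 0 < b) (hc : 0 < c) (hb' : b < 2 * Real.pi)
    (hc' : c < 2 * Real.pi) :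
    Real.sin ((a + b - c) / 2) * Real.sin ((a + c - b) / 2) ≤
      (Real.sin (a / 2) + Real.sin (b / 2) - Real.sin (c / 2)) *
        (Real.sin (a / 2) + Real.sin (c / 2) - Real.sin (b / 2)) := by
  have h₁ := sin_sub_sq_sub_sub_sin_sq (b / 2) (c / 2)
  have h₂ := sin_add_mul_sin_sub (a / 2) (b / 2 - c / 2)
  rw [show (a + b - c) / 2 = a / 2 + (b / 2 - c / 2) by ring,
    show (a + c - b) / 2 = a / 2 - (b / 2 - c / 2) by ring]
  have hsb : 0 < Real.sin (b / 2) := Real.sin_pos_of_pos_of_lt_pi (by linarith) (by linarith)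
  have hsc : 0 < Real.sin (c / 2) := Real.sin_pos_of_pos_of_lt_pi (by linarith) (by linarith)
  have h₃ : 0 ≤ 4 * Real.sin ((b / 2 - c / 2) / 2) ^ 2 *
      (Real.sin (b / 2) * Real.sin (c / 2)) := by positivity
  linarith

/-- Equality in `spherical_pair_le` forces `b = c`. -/
theorem spherical_pair_eq {a b c : ℝ} (hb : 0 < b) (hc : 0 < c) (hb' : b < 2 * Real.pi)
    (hc' : c < 2 * Real.pi)
    (h : Real.sin ((a + b - c) / 2) * Real.sin ((a + c - b) / 2) =
      (Real.sin (a / 2) + Real.sin (b / 2) - Real.sin (c / 2)) *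
        (Real.sin (a / 2) + Real.sin (c / 2) - Real.sin (b / 2))) : b = c := by
  have h₁ := sin_sub_sq_sub_sub_sin_sq (b / 2) (c / 2)
  have h₂ := sin_add_mul_sin_sub (a / 2) (b / 2 - c / 2)
  rw [show (a + b - c) / 2 = a / 2 + (b / 2 - c / 2) by ring,
    show (a + c - b) / 2 = a / 2 - (b / 2 - c / 2) by ring] at h
  have hsb : 0 < Real.sin (b / 2) := Real.sin_pos_of_pos_of_lt_pi (by linarith) (by linarith)
  have hsc : 0 < Real.sin (c / 2) := Real.sin_pos_of_pos_of_lt_pi (by linarith) (by linarith)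
  have h₃ : 4 * Real.sin ((b / 2 - c / 2) / 2) ^ 2 *
      (Real.sin (b / 2) * Real.sin (c / 2)) = 0 := by linarith
  have h₄ : Real.sin ((b / 2 - c / 2) / 2) = 0 := by
    simpa [hsb.ne', hsc.ne'] using h₃
  rw [Real.sin_eq_zero_iff_of_lt_of_lt (by linarith) (by linarith)] at h₄
  linarith

/-- Pairwise comparison of products of three positive reals gives comparison of the products. -/
theorem mul_mul_le_of_pairwise_mul_le {x y z p q r : ℝ} (hx : 0 < x) (hy : 0 < y) (hz : 0 < z)
    (hp : 0 < p) (hq : 0 < q) (hr : 0 < r) (hxy : x * y ≤ p * q) (hxz : x * z ≤ p * r)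
    (hyz : y * z ≤ q * r) : x * y * z ≤ p * q * r := by
  refine le_of_sq_le_sq ?_ (by positivity)
  calc (x * y * z) ^ 2 = x * y * (x * z) * (y * z) := by ring
    _ ≤ p * q * (p * r) * (q * r) := by gcongr
    _ = (p * q * r) ^ 2 := by ring

/-- Equality of the triple products in `mul_mul_le_of_pairwise_mul_le` forces equality of pairs. -/
theorem mul_eq_mul_of_mul_mul_eq {x y z p q r : ℝ} (hx : 0 < x) (hy : 0 < y) (hz : 0 < z)
    (hp : 0 < p) (hq : 0 < q) (hr : 0 < r) (hxy : x * y ≤ p * q) (hxz : x * z ≤ p * r)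
    (hyz : y * z ≤ q * r) (h : x * y * z = p * q * r) : x * y = p * q := by
  refine le_antisymm hxy (le_of_not_gt fun hlt => ?_)
  have h₁ : x * y * (x * z * (y * z)) < p * q * (p * r * (q * r)) := by
    refine mul_lt_mul hlt (mul_le_mul hxz hyz ?_ ?_) ?_ ?_ <;> positivity
  have h₂ : x * y * (x * z * (y * z)) = p * q * (p * r * (q * r)) := by
    linear_combination (x * y * z + p * q * r) * h
  exact h₁.ne h₂

/-- For a spherical triangle with side lengths `a, b, c`, one has `J ≤ J̄`,
with equality if and only if the triangle is equilateral, where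
`J = √(sin((a+b−c)/2)·sin((a+c−b)/2)·sin((b+c−a)/2))` and
`J̄ = √((s a + s b − s c)·(s a + s c − s b)·(s b + s c − s a))` with `s x = sin (x/2)`. -/
theorem spherical_J_le_Jbar (a b c : ℝ)
    (ha : 0 < a) (hb : 0 < b) (hc : 0 < c)
    (habc : a < b + c) (hbac : b < a + c) (hcab : c < a + b)
    (hsum : a + b + c < 2 * Real.pi) :
    Real.sqrt (Real.sin ((a + b - c) / 2) * Real.sin ((a + c - b) / 2) *
        Real.sin ((b + c - a) / 2)) ≤
      Real.sqrt ((Real.sin (a / 2) + Real.sin (b / 2) - Real.sin (c / 2)) *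
        (Real.sin (a / 2) + Real.sin (c / 2) - Real.sin (b / 2)) *
        (Real.sin (b / 2) + Real.sin (c / 2) - Real.sin (a / 2))) ∧
    (Real.sqrt (Real.sin ((a + b - c) / 2) * Real.sin ((a + c - b) / 2) *
        Real.sin ((b + c - a) / 2)) =
      Real.sqrt ((Real.sin (a / 2) + Real.sin (b / 2) - Real.sin (c / 2)) *
        (Real.sin (a / 2) + Real.sin (c / 2) - Real.sin (b / 2)) *
        (Real.sin (b / 2) + Real.sin (c / 2) - Real.sin (a / 2))) ↔
      a = b ∧ b = c) := by
  have hx : 0 < Real.sin ((a + b - c) / 2) :=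
    Real.sin_pos_of_pos_of_lt_pi (by linarith) (by linarith)
  have hy : 0 < Real.sin ((a + c - b) / 2) :=
    Real.sin_pos_of_pos_of_lt_pi (by linarith) (by linarith)
  have hz : 0 < Real.sin ((b + c - a) / 2) :=
    Real.sin_pos_of_pos_of_lt_pi (by linarith) (by linarith)
  have hsa : 0 < Real.sin (a / 2) := Real.sin_pos_of_pos_of_lt_pi (by linarith) (by linarith)
  have hsb : 0 < Real.sin (b / 2) := Real.sin_pos_of_pos_of_lt_pi (by linarith) (by linarith)
  have hsc : 0 < Real.sin (c / 2) := Real.sin_pos_of_pos_of_lt_pi (by linarith) (by linarith)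
  have ha' : a < 2 * Real.pi := by linarith
  have hb' : b < 2 * Real.pi := by linarith
  have hc' : c < 2 * Real.pi := by linarith
  have hxy := spherical_pair_le (a := a) hb hc hb' hc'
  have hxz := spherical_pair_le (a := b) ha hc ha' hc'
  have hyz := spherical_pair_le (a := c) ha hb ha' hb'
  have exy := spherical_pair_eq (a := a) hb hc hb' hc'
  have exz := spherical_pair_eq (a := b) ha hc ha' hc'
  rw [add_comm b a, add_comm (Real.sin (b / 2)) (Real.sin (a / 2))] at hxz exz
  rw [add_comm c a, add_comm c b, add_comm (Real.sin (c / 2)) (Real.sin (a / 2)),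
    add_comm (Real.sin (c / 2)) (Real.sin (b / 2))] at hyz
  set x := Real.sin ((a + b - c) / 2)
  set y := Real.sin ((a + c - b) / 2)
  set z := Real.sin ((b + c - a) / 2)
  set p := Real.sin (a / 2) + Real.sin (b / 2) - Real.sin (c / 2)
  set q := Real.sin (a / 2) + Real.sin (c / 2) - Real.sin (b / 2)
  set r := Real.sin (b / 2) + Real.sin (c / 2) - Real.sin (a / 2)
  have hpq : 0 < p * q := (mul_pos hx hy).trans_le hxy
  have hpr : 0 < p * r := (mul_pos hx hz).trans_le hxz
  have hp : 0 < p := by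
    rcases pos_and_pos_or_neg_and_neg_of_mul_pos hpq with h | h
    · exact h.1
    · linarith [h.1, h.2]
  have hq : 0 < q := (mul_pos_iff_of_pos_left hp).1 hpq
  have hr : 0 < r := (mul_pos_iff_of_pos_left hp).1 hpr
  refine ⟨Real.sqrt_le_sqrt
    (mul_mul_le_of_pairwise_mul_le hx hy hz hp hq hr hxy hxz hyz), fun h => ?_, ?_⟩
  · rw [Real.sqrt_inj (by positivity) (by positivity)] at h
    have hbc : b = c := exy (mul_eq_mul_of_mul_mul_eq hx hy hz hp hq hr hxy hxz hyz h)
    have hac : a = c := exz (mul_eq_mul_of_mul_mul_eq hx hz hy hp hr hq hxz hxy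
      (by linarith) (by linarith))
    exact ⟨hac.trans hbc.symm, hbc⟩
  · rintro ⟨rfl, rfl⟩
    simp [x, y, z, p, q, r]
end

section
/- If a, b, c are the side lengths of a hyperbolic triangle, then J̄ ≤ J, with equality if and only if a = b = c. -/
namespace Real

theorem sq_sinh_sub_sinh (x y : ℝ) :
    (sinh x - sinh y) ^ 2 =
      sinh (x - y) ^ 2 + 2 * (cosh (x - y) - 1) * (sinh x * sinh y) := by
  rw [sinh_sub, cosh_sub]
  linear_combination (-sinh y ^ 2) * cosh_sq x - sinh x ^ 2 * cosh_sq y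

theorem sinh_add_mul_sinh_sub (x y : ℝ) :
    sinh (x + y) * sinh (x - y) = sinh x ^ 2 - sinh y ^ 2 := by
  rw [sinh_add, sinh_sub]
  linear_combination sinh x ^ 2 * cosh_sq y - sinh y ^ 2 * cosh_sq x

/-- The pairwise defect between products of hyperbolic and Euclidean triangle factors. -/
theorem sinh_triangle_factors_mul (x y z : ℝ) :
    sinh (x + y - z) * sinh (x + z - y) =
      (sinh x + sinh y - sinh z) * (sinh x + sinh z - sinh y) +
        2 * (cosh (y - z) - 1) * (sinh y * sinh z) := by
  have h := sinh_add_mul_sinh_sub x (y - z)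
  rw [show x + (y - z) = x + y - z by ring, show x - (y - z) = x + z - y by ring] at h
  linear_combination h + sq_sinh_sub_sinh y z

theorem sinh_triangle_factors_mul_le {x y z : ℝ} (hy : 0 < y) (hz : 0 < z) :
    (sinh x + sinh y - sinh z) * (sinh x + sinh z - sinh y) ≤
      sinh (x + y - z) * sinh (x + z - y) := by
  have h : 0 ≤ cosh (y - z) - 1 := sub_nonneg.2 (one_le_cosh _)
  have hy' := sinh_pos_iff.2 hy
  have hz' := sinh_pos_iff.2 hz
  rw [sinh_triangle_factors_mul, le_add_iff_nonneg_right]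
  positivity

theorem sinh_triangle_factors_mul_lt {x y z : ℝ} (hy : 0 < y) (hz : 0 < z) (hyz : y ≠ z) :
    (sinh x + sinh y - sinh z) * (sinh x + sinh z - sinh y) <
      sinh (x + y - z) * sinh (x + z - y) := by
  have h : 0 < cosh (y - z) - 1 := sub_pos.2 (one_lt_cosh.2 (sub_ne_zero.2 hyz))
  have hy' := sinh_pos_iff.2 hy
  have hz' := sinh_pos_iff.2 hz
  rw [sinh_triangle_factors_mul, lt_add_iff_pos_right]
  positivity

end Real

/-- Comparing all pairwise products, one of them strictly, compares triple products. -/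
theorem mul_mul_lt_of_pairwise_mul_le {x y z x' y' z' : ℝ}
    (hx : 0 < x) (hy : 0 < y) (hz : 0 < z) (hx' : 0 < x') (hy' : 0 < y') (hz' : 0 < z')
    (hxy : x * y < x' * y') (hxz : x * z ≤ x' * z') (hyz : y * z ≤ y' * z') :
    x * y * z < x' * y' * z' := by
  have h : (x * y) * ((x * z) * (y * z)) < (x' * y') * ((x' * z') * (y' * z')) :=
    mul_lt_mul hxy (mul_le_mul hxz hyz (by positivity) (by positivity))
      (by positivity) (by positivity)
  refine lt_of_pow_lt_pow_left₀ 2 (by positivity) ?_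
  linear_combination h

/-- If a product of three reals is positive and the sums of `x` with the other two factors are
positive, then `x` is positive. -/
theorem pos_of_mul_mul_pos_of_add_pos {x y z : ℝ} (hxy : 0 < x + y) (hxz : 0 < x + z)
    (h : 0 < x * y * z) : 0 < x := by
  by_contra! hx
  have hy : 0 < y := by linarith
  have hz : 0 < z := by linarith
  exact h.not_ge (mul_nonpos_of_nonpos_of_nonneg
    (mul_nonpos_of_nonpos_of_nonneg hx hy.le) hz.le)

theorem Real.sinh_triangle_factors_prod_lt {x y z : ℝ} (hx : 0 < x) (hy : 0 < y) (hz : 0 < z)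
    (hxyz : x < y + z) (hyxz : y < x + z) (hzxy : z < x + y) (hne : ¬(x = y ∧ y = z)) :
    (sinh x + sinh y - sinh z) * (sinh x + sinh z - sinh y) * (sinh y + sinh z - sinh x) <
      sinh (x + y - z) * sinh (x + z - y) * sinh (y + z - x) := by
  have hA : 0 < sinh (x + y - z) := sinh_pos_iff.2 (by linarith)
  have hB : 0 < sinh (x + z - y) := sinh_pos_iff.2 (by linarith)
  have hC : 0 < sinh (y + z - x) := sinh_pos_iff.2 (by linarith)
  have hsx := sinh_pos_iff.2 hx
  have hsy := sinh_pos_iff.2 hy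
  have hsz := sinh_pos_iff.2 hz
  have hAB := sinh_triangle_factors_mul_le (x := x) hy hz
  have hAC := sinh_triangle_factors_mul_le (x := y) hx hz
  have hBC := sinh_triangle_factors_mul_le (x := z) hx hy
  have hAB' := sinh_triangle_factors_mul_lt (x := x) hy hz
  have hAC' := sinh_triangle_factors_mul_lt (x := y) hx hz
  rw [add_comm y x, add_comm (sinh y) (sinh x)] at hAC hAC'
  rw [add_comm z x, add_comm (sinh z) (sinh x), add_comm z y, add_comm (sinh z) (sinh y)]
    at hBC
  set A' := sinh (x + y - z)
  set B' := sinh (x + z - y)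
  set C' := sinh (y + z - x)
  rcases le_or_gt ((sinh x + sinh y - sinh z) * (sinh x + sinh z - sinh y) *
    (sinh y + sinh z - sinh x)) 0 with hP | hP
  · exact hP.trans_lt (by positivity)
  have sAB : 0 < (sinh x + sinh y - sinh z) + (sinh x + sinh z - sinh y) := by linarith
  have sAC : 0 < (sinh x + sinh y - sinh z) + (sinh y + sinh z - sinh x) := by linarith
  have sBC : 0 < (sinh x + sinh z - sinh y) + (sinh y + sinh z - sinh x) := by linarith
  generalize sinh x + sinh y - sinh z = A at *
  generalize sinh x + sinh z - sinh y = B at *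
  generalize sinh y + sinh z - sinh x = C at *
  have pA : 0 < A := pos_of_mul_mul_pos_of_add_pos sAB sAC hP
  have pB : 0 < B := pos_of_mul_mul_pos_of_add_pos (by linarith) sBC (by linarith : 0 < B * A * C)
  have pC : 0 < C := pos_of_mul_mul_pos_of_add_pos (by linarith) (by linarith)
    (by linarith : 0 < C * A * B)
  by_cases hyz : y = z
  · have hxz : x ≠ z := fun h => hne ⟨h.trans hyz.symm, hyz⟩
    have := mul_mul_lt_of_pairwise_mul_le pA pC pB hA hC hB (hAC' hxz) hAB
      (by linarith)
    linarith
  · exact mul_mul_lt_of_pairwise_mul_le pA pB pC hA hB hC (hAB' hyz) hAC hBC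

/-- For a hyperbolic triangle with side lengths `a, b, c`, one has `J̄ ≤ J`,
with equality if and only if the triangle is equilateral, where
`J = √(sinh((a+b−c)/2)·sinh((a+c−b)/2)·sinh((b+c−a)/2))` and
`J̄ = √((s a + s b − s c)·(s a + s c − s b)·(s b + s c − s a))` with `s x = sinh (x/2)`. -/
theorem hyperbolic_Jbar_le_J (a b c : ℝ)
    (ha : 0 < a) (hb : 0 < b) (hc : 0 < c)
    (habc : a < b + c) (hbac : b < a + c) (hcab : c < a + b) :
    Real.sqrt ((Real.sinh (a / 2) + Real.sinh (b / 2) - Real.sinh (c / 2)) *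
        (Real.sinh (a / 2) + Real.sinh (c / 2) - Real.sinh (b / 2)) *
        (Real.sinh (b / 2) + Real.sinh (c / 2) - Real.sinh (a / 2))) ≤
      Real.sqrt (Real.sinh ((a + b - c) / 2) * Real.sinh ((a + c - b) / 2) *
        Real.sinh ((b + c - a) / 2)) ∧
    (Real.sqrt ((Real.sinh (a / 2) + Real.sinh (b / 2) - Real.sinh (c / 2)) *
        (Real.sinh (a / 2) + Real.sinh (c / 2) - Real.sinh (b / 2)) *
        (Real.sinh (b / 2) + Real.sinh (c / 2) - Real.sinh (a / 2))) =
      Real.sqrt (Real.sinh ((a + b - c) / 2) * Real.sinh ((a + c - b) / 2) *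
        Real.sinh ((b + c - a) / 2)) ↔
      a = b ∧ b = c) := by
  have e₁ : (a + b - c) / 2 = a / 2 + b / 2 - c / 2 := by ring
  have e₂ : (a + c - b) / 2 = a / 2 + c / 2 - b / 2 := by ring
  have e₃ : (b + c - a) / 2 = b / 2 + c / 2 - a / 2 := by ring
  by_cases h : a = b ∧ b = c
  · obtain ⟨rfl, rfl⟩ := h
    simp
  · have hlt := Real.sqrt_lt_sqrt_iff_of_pos (mul_pos (mul_pos
      (Real.sinh_pos_iff.2 (by linarith : 0 < (a + b - c) / 2))
      (Real.sinh_pos_iff.2 (by linarith : 0 < (a + c - b) / 2)))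
      (Real.sinh_pos_iff.2 (by linarith : 0 < (b + c - a) / 2))) |>.2 (by
        rw [e₁, e₂, e₃]
        exact Real.sinh_triangle_factors_prod_lt (x := a / 2) (y := b / 2) (z := c / 2)
          (by linarith) (by linarith) (by linarith) (by linarith) (by linarith) (by linarith)
          (fun h' => h ⟨by linarith [h'.1], by linarith [h'.2]⟩))
    exact ⟨hlt.le, iff_of_false hlt.ne h⟩
end

section
/- For all positive reals x, y, z, sinh(x)·sinh(y)·sinh(z) ≤ sinh((x+y)/2)·sinh((x+z)/2)·sinh((y+z)/2). -/
theorem sinh_mul_sinh_le_sq (a b : ℝ) :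
    Real.sinh a * Real.sinh b ≤ Real.sinh ((a + b) / 2) ^ 2 := by
  obtain ⟨u, v, rfl, rfl⟩ : ∃ u v : ℝ, a = u + v ∧ b = u - v :=
    ⟨(a + b) / 2, (a - b) / 2, by ring, by ring⟩
  have h : (u + v + (u - v)) / 2 = u := by ring
  rw [h, Real.sinh_add, Real.sinh_sub]
  nlinarith [Real.cosh_sq u, Real.cosh_sq v, sq_nonneg (Real.sinh v)]

/-- For all positive reals `x, y, z`,
`sinh x · sinh y · sinh z ≤ sinh ((x+y)/2) · sinh ((x+z)/2) · sinh ((y+z)/2)`. -/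
theorem sinh_prod_le (x y z : ℝ) (hx : 0 < x) (hy : 0 < y) (hz : 0 < z) :
    Real.sinh x * Real.sinh y * Real.sinh z ≤
      Real.sinh ((x + y) / 2) * Real.sinh ((x + z) / 2) * Real.sinh ((y + z) / 2) := by
  have hxy := sinh_mul_sinh_le_sq x y
  have hxz := sinh_mul_sinh_le_sq x z
  have hyz := sinh_mul_sinh_le_sq y z
  have sx := Real.sinh_pos_iff.2 hx
  have sy := Real.sinh_pos_iff.2 hy
  have sz := Real.sinh_pos_iff.2 hz
  have sxy : 0 < Real.sinh ((x + y) / 2) := Real.sinh_pos_iff.2 (by positivity)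
  have sxz : 0 < Real.sinh ((x + z) / 2) := Real.sinh_pos_iff.2 (by positivity)
  have syz : 0 < Real.sinh ((y + z) / 2) := Real.sinh_pos_iff.2 (by positivity)
  refine (sq_le_sq₀ (by positivity) (by positivity)).1 ?_
  calc (Real.sinh x * Real.sinh y * Real.sinh z) ^ 2
      = (Real.sinh x * Real.sinh y) * (Real.sinh x * Real.sinh z) *
          (Real.sinh y * Real.sinh z) := by ring
    _ ≤ Real.sinh ((x + y) / 2) ^ 2 * Real.sinh ((x + z) / 2) ^ 2 *
          Real.sinh ((y + z) / 2) ^ 2 := by gcongr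
    _ = _ := by ring
end

section
/- If a, b, c are the side lengths of a spherical triangle and a ≥ b ≥ c, then sin((b+c−a)/2) ≤ sin(b/2) + sin(c/2) − sin(a/2), with equality if and only if a = b. -/
/-- The defect in the spherical inequality factors as a product of three sines. -/
theorem sin_half_defect_eq (a b c : ℝ) :
    Real.sin (b / 2) + Real.sin (c / 2) - Real.sin (a / 2) - Real.sin ((b + c - a) / 2) =
      4 * Real.sin ((b + c) / 4) * Real.sin ((a - c) / 4) * Real.sin ((a - b) / 4) := by
  obtain ⟨p, hp⟩ : ∃ p, p = (b + c) / 4 := ⟨_, rfl⟩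
  obtain ⟨q, hq⟩ : ∃ q, q = (a - c) / 4 := ⟨_, rfl⟩
  obtain ⟨r, hr⟩ : ∃ r, r = (a - b) / 4 := ⟨_, rfl⟩
  rw [← hp, ← hq, ← hr, show b / 2 = p + q - r by linarith, show c / 2 = p - q + r by linarith,
    show a / 2 = p + q + r by linarith, show (b + c - a) / 2 = p - q - r by linarith]
  simp only [Real.sin_add, Real.sin_sub, Real.cos_add, Real.cos_sub]
  ring

/-- For a spherical triangle with side lengths `a ≥ b ≥ c`,
`sin ((b+c−a)/2) ≤ sin (b/2) + sin (c/2) − sin (a/2)`, with equality iff `a = b`. -/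
theorem spherical_p1 (a b c : ℝ)
    (ha : 0 < a) (hb : 0 < b) (hc : 0 < c)
    (habc : a < b + c) (hbac : b < a + c) (hcab : c < a + b)
    (hsum : a + b + c < 2 * Real.pi)
    (hab : b ≤ a) (hbc : c ≤ b) :
    Real.sin ((b + c - a) / 2) ≤ Real.sin (b / 2) + Real.sin (c / 2) - Real.sin (a / 2) ∧
    (Real.sin ((b + c - a) / 2) = Real.sin (b / 2) + Real.sin (c / 2) - Real.sin (a / 2) ↔
      a = b) := by
  rcases hab.eq_or_lt with rfl | hlt
  · simp
  · have key := sin_half_defect_eq a b c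
    have hp : 0 < Real.sin ((b + c) / 4) :=
      Real.sin_pos_of_pos_of_lt_pi (by linarith) (by linarith)
    have hq : 0 < Real.sin ((a - c) / 4) :=
      Real.sin_pos_of_pos_of_lt_pi (by linarith) (by linarith)
    have hr : 0 < Real.sin ((a - b) / 4) :=
      Real.sin_pos_of_pos_of_lt_pi (by linarith) (by linarith)
    have hpos : 0 < 4 * Real.sin ((b + c) / 4) * Real.sin ((a - c) / 4) *
        Real.sin ((a - b) / 4) := by positivity
    exact ⟨by linarith, fun h => by linarith, fun h => by linarith⟩
end

section
/- If a, b, c are the side lengths of a spherical triangle and a ≥ b ≥ c, then sin((a+b−c)/2)·sin((a+c−b)/2) ≤ (sin(a/2) + sin(b/2) − sin(c/2))·(sin(a/2) + sin(c/2) − sin(b/2)), with equality if and only if b = c. -/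
/-- The right side minus the left side, factored through `d = (b - c) / 4` and `m = (b + c) / 4`. -/
lemma spherical_p2_sub (a b c : ℝ) :
    (Real.sin (a / 2) + Real.sin (b / 2) - Real.sin (c / 2)) *
        (Real.sin (a / 2) + Real.sin (c / 2) - Real.sin (b / 2)) -
      Real.sin ((a + b - c) / 2) * Real.sin ((a + c - b) / 2) =
    4 * Real.sin ((b - c) / 4) ^ 2 *
      (Real.cos ((b - c) / 4) ^ 2 - Real.cos ((b + c) / 4) ^ 2) := by
  have hdiff : Real.sin (b / 2) - Real.sin (c / 2) =
      2 * Real.sin ((b - c) / 4) * Real.cos ((b + c) / 4) := by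
    rw [Real.sin_sub_sin]; ring_nf
  have hdouble : Real.sin ((b - c) / 2) =
      2 * Real.sin ((b - c) / 4) * Real.cos ((b - c) / 4) := by
    rw [← Real.sin_two_mul]; ring_nf
  have hprod : Real.sin ((a + b - c) / 2) * Real.sin ((a + c - b) / 2) =
      Real.sin (a / 2) ^ 2 - Real.sin ((b - c) / 2) ^ 2 := by
    rw [show (a + b - c) / 2 = a / 2 + (b - c) / 2 by ring,
      show (a + c - b) / 2 = a / 2 - (b - c) / 2 by ring, Real.sin_add, Real.sin_sub]
    linear_combination Real.sin (a / 2) ^ 2 * Real.sin_sq_add_cos_sq ((b - c) / 2) -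
      Real.sin ((b - c) / 2) ^ 2 * Real.sin_sq_add_cos_sq (a / 2)
  rw [hprod, hdouble]
  linear_combination (-(Real.sin (b / 2) - Real.sin (c / 2)) -
    2 * Real.sin ((b - c) / 4) * Real.cos ((b + c) / 4)) * hdiff


/-- For a spherical triangle with side lengths `a ≥ b ≥ c`,
`sin ((a+b−c)/2) · sin ((a+c−b)/2) ≤ (sin (a/2) + sin (b/2) − sin (c/2)) · (sin (a/2) + sin (c/2) − sin (b/2))`,
with equality iff `b = c`. -/
theorem spherical_p2 (a b c : ℝ)
    (ha : 0 < a) (hb : 0 < b) (hc : 0 < c)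
    (habc : a < b + c) (hbac : b < a + c) (hcab : c < a + b)
    (hsum : a + b + c < 2 * Real.pi)
    (hab : b ≤ a) (hbc : c ≤ b) :
    Real.sin ((a + b - c) / 2) * Real.sin ((a + c - b) / 2) ≤
      (Real.sin (a / 2) + Real.sin (b / 2) - Real.sin (c / 2)) *
        (Real.sin (a / 2) + Real.sin (c / 2) - Real.sin (b / 2)) ∧
    (Real.sin ((a + b - c) / 2) * Real.sin ((a + c - b) / 2) =
      (Real.sin (a / 2) + Real.sin (b / 2) - Real.sin (c / 2)) *
        (Real.sin (a / 2) + Real.sin (c / 2) - Real.sin (b / 2)) ↔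
      b = c) := by
  have hsub := spherical_p2_sub a b c
  have hcos : 0 < Real.cos ((b - c) / 4) ^ 2 - Real.cos ((b + c) / 4) ^ 2 := by
    have hpos : 0 < Real.cos ((b + c) / 4) :=
      Real.cos_pos_of_mem_Ioo ⟨by linarith, by linarith⟩
    have hlt : Real.cos ((b + c) / 4) < Real.cos ((b - c) / 4) :=
      Real.cos_lt_cos_of_nonneg_of_le_pi (by linarith) (by linarith) (by linarith)
    nlinarith
  refine ⟨sub_nonneg.mp (hsub ▸ by positivity), fun h => ?_, fun h => ?_⟩
  · by_contra hne
    have hlt : c < b := lt_of_le_of_ne hbc (Ne.symm hne)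
    have hsin : 0 < Real.sin ((b - c) / 4) :=
      Real.sin_pos_of_pos_of_lt_pi (by linarith) (by linarith)
    have : 0 < 4 * Real.sin ((b - c) / 4) ^ 2 *
        (Real.cos ((b - c) / 4) ^ 2 - Real.cos ((b + c) / 4) ^ 2) := by positivity
    linarith
  · subst h
    simp only [sub_self, zero_div, Real.sin_zero] at hsub
    linarith
end

section
/- If a, b, c are the side lengths of a hyperbolic triangle and a ≥ b ≥ c, then sinh((b+c−a)/2) ≥ sinh(b/2) + sinh(c/2) − sinh(a/2), with equality if and only if a = b. -/
/-- The sum-to-product identity for four hyperbolic sines. -/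
theorem sinh_add_sinh_sub_sinh_sub_sinh (u v w : ℝ) :
    Real.sinh (u - v - w) + Real.sinh (u + v + w) - Real.sinh (u + v - w) -
      Real.sinh (u - v + w) = 4 * (Real.sinh u * Real.sinh v * Real.sinh w) := by
  simp only [Real.sinh_add, Real.sinh_sub, Real.cosh_add, Real.cosh_sub]
  ring

/-- For a hyperbolic triangle with side lengths `a ≥ b ≥ c`,
`sinh ((b+c−a)/2) ≥ sinh (b/2) + sinh (c/2) − sinh (a/2)`, with equality iff `a = b`. -/
theorem hyperbolic_p1 (a b c : ℝ)
    (ha : 0 < a) (hb : 0 < b) (hc : 0 < c)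
    (habc : a < b + c) (hbac : b < a + c) (hcab : c < a + b)
    (hab : b ≤ a) (hbc : c ≤ b) :
    Real.sinh (b / 2) + Real.sinh (c / 2) - Real.sinh (a / 2) ≤
      Real.sinh ((b + c - a) / 2) ∧
    (Real.sinh ((b + c - a) / 2) = Real.sinh (b / 2) + Real.sinh (c / 2) - Real.sinh (a / 2) ↔
      a = b) := by
  have key := sinh_add_sinh_sub_sinh_sub_sinh ((b + c) / 4) ((a - c) / 4) ((a - b) / 4)
  rw [show (b + c) / 4 - (a - c) / 4 - (a - b) / 4 = (b + c - a) / 2 by ring,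
    show (b + c) / 4 + (a - c) / 4 + (a - b) / 4 = a / 2 by ring,
    show (b + c) / 4 + (a - c) / 4 - (a - b) / 4 = b / 2 by ring,
    show (b + c) / 4 - (a - c) / 4 + (a - b) / 4 = c / 2 by ring] at key
  have hu : 0 < Real.sinh ((b + c) / 4) := Real.sinh_pos_iff.2 (by linarith)
  have hv : 0 ≤ Real.sinh ((a - c) / 4) := Real.sinh_nonneg_iff.2 (by linarith)
  have hw : 0 ≤ Real.sinh ((a - b) / 4) := Real.sinh_nonneg_iff.2 (by linarith)
  have huvw := mul_nonneg (mul_nonneg hu.le hv) hw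
  refine ⟨by linarith, fun h => ?_, fun h => ?_⟩
  · have hzero : Real.sinh ((b + c) / 4) * Real.sinh ((a - c) / 4) *
        Real.sinh ((a - b) / 4) = 0 := by linarith
    rcases mul_eq_zero.1 hzero with h' | h'
    · have := Real.sinh_eq_zero.1 ((mul_eq_zero.1 h').resolve_left hu.ne')
      linarith
    · have := Real.sinh_eq_zero.1 h'
      linarith
  · subst h
    simp
end

section
/- If a, b, c are the side lengths of a hyperbolic triangle and a ≥ b ≥ c, then sinh((a+b−c)/2)·sinh((a+c−b)/2) ≥ (sinh(a/2) + sinh(b/2) − sinh(c/2))·(sinh(a/2) + sinh(c/2) − sinh(b/2)), with equality if and only if b = c. -/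
/-- `sinh` is strictly superadditive on the positive reals. -/
theorem Real.sinh_add_sinh_lt_sinh_add {x y : ℝ} (hx : 0 < x) (hy : 0 < y) :
    Real.sinh x + Real.sinh y < Real.sinh (x + y) := by
  have hsx : 0 < Real.sinh x := Real.sinh_pos_iff.mpr hx
  have hsy : 0 < Real.sinh y := Real.sinh_pos_iff.mpr hy
  have hcx : 1 < Real.cosh x := Real.one_lt_cosh.mpr hx.ne'
  have hcy : 1 < Real.cosh y := Real.one_lt_cosh.mpr hy.ne'
  rw [Real.sinh_add]
  nlinarith

theorem Real.sinh_add_mul_sinh_sub_s12 (x y : ℝ) :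
    Real.sinh (x + y) * Real.sinh (x - y) = Real.sinh x ^ 2 - Real.sinh y ^ 2 := by
  rw [Real.sinh_add, Real.sinh_sub]
  linear_combination Real.sinh x ^ 2 * Real.cosh_sq y - Real.sinh y ^ 2 * Real.cosh_sq x

/-- For a hyperbolic triangle with side lengths `a ≥ b ≥ c`,
`sinh ((a+b−c)/2) · sinh ((a+c−b)/2) ≥ (sinh (a/2) + sinh (b/2) − sinh (c/2)) · (sinh (a/2) + sinh (c/2) − sinh (b/2))`,
with equality iff `b = c`. -/
theorem hyperbolic_p2 (a b c : ℝ)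
    (ha : 0 < a) (hb : 0 < b) (hc : 0 < c)
    (habc : a < b + c) (hbac : b < a + c) (hcab : c < a + b)
    (hab : b ≤ a) (hbc : c ≤ b) :
    (Real.sinh (a / 2) + Real.sinh (b / 2) - Real.sinh (c / 2)) *
        (Real.sinh (a / 2) + Real.sinh (c / 2) - Real.sinh (b / 2)) ≤
      Real.sinh ((a + b - c) / 2) * Real.sinh ((a + c - b) / 2) ∧
    (Real.sinh ((a + b - c) / 2) * Real.sinh ((a + c - b) / 2) =
      (Real.sinh (a / 2) + Real.sinh (b / 2) - Real.sinh (c / 2)) *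
        (Real.sinh (a / 2) + Real.sinh (c / 2) - Real.sinh (b / 2)) ↔
      b = c) := by
  have hprod : Real.sinh ((a + b - c) / 2) * Real.sinh ((a + c - b) / 2) =
      Real.sinh (a / 2) ^ 2 - Real.sinh ((b - c) / 2) ^ 2 := by
    rw [← Real.sinh_add_mul_sinh_sub_s12]
    ring_nf
  rw [hprod]
  rcases hbc.eq_or_lt with rfl | hlt
  · simp [sq]
  · have hd : 0 < (b - c) / 2 := by linarith
    have hsd : 0 < Real.sinh ((b - c) / 2) := Real.sinh_pos_iff.mpr hd
    have hsuper := Real.sinh_add_sinh_lt_sinh_add hd (half_pos hc)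
    rw [show (b - c) / 2 + c / 2 = b / 2 by ring] at hsuper
    have hstrict : (Real.sinh (a / 2) + Real.sinh (b / 2) - Real.sinh (c / 2)) *
        (Real.sinh (a / 2) + Real.sinh (c / 2) - Real.sinh (b / 2)) <
        Real.sinh (a / 2) ^ 2 - Real.sinh ((b - c) / 2) ^ 2 := by
      nlinarith
    exact ⟨hstrict.le, iff_of_false hstrict.ne' hlt.ne'⟩
end

section
/- Let n be a real number and let f : ℝ → ℝ → ℝ and g : ℝ → ℝ → ℝ → ℝ satisfy f(λx, λy) = λ^n·f(x, y) and g(λx, λy, λz) = λ^n·g(x, y, z) for all λ > 0 and all x, y, z > 0. Suppose (i) for all positive reals a, b, c satisfying the strict triangle inequalities, f(R_E(a,b,c), r_E(a,b,c)) ≥ g(a, b, c), with equality if and only if a = b = c; and (ii) for every M > 0, whenever 0 < x₁ ≤ x₂ ≤ M one has f(2M²/x₁, x₁) ≥ f(2M²/x₂, x₂). Then for all side lengths a, b, c of a spherical triangle, f(T_R, T_r) ≥ 2^n · g(s(a), s(b), s(c)) · ((s(a)+s(b)+s(c))/sin((a+b+c)/2))^{n/2}, with equality if and only if a = b = c. 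-/
/-- Circumradius of the Euclidean triangle with side lengths `a, b, c`. -/
noncomputable def euclideanCircumradius (a b c : ℝ) : ℝ :=
  a * b * c / Real.sqrt ((a + b + c) * (b + c - a) * (a + c - b) * (a + b - c))

/-- Inradius of the Euclidean triangle with side lengths `a, b, c`. -/
noncomputable def euclideanInradius (a b c : ℝ) : ℝ :=
  (1 / 2) * Real.sqrt ((b + c - a) * (a + c - b) * (a + b - c) / (a + b + c))

/-- The quantity `J` of a spherical triangle with side lengths `a, b, c`. -/
noncomputable def sphJ (a b c : ℝ) : ℝ :=
  Real.sqrt (Real.sin ((a + b - c) / 2) * Real.sin ((a + c - b) / 2) *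
    Real.sin ((b + c - a) / 2))

/-- `tan R` for the circumradius `R` of a spherical triangle with side lengths `a, b, c`. -/
noncomputable def sphTanR (a b c : ℝ) : ℝ :=
  2 * Real.sin (a / 2) * Real.sin (b / 2) * Real.sin (c / 2) /
    (sphJ a b c * Real.sqrt (Real.sin ((a + b + c) / 2)))

/-- `tan r` for the inradius `r` of a spherical triangle with side lengths `a, b, c`. -/
noncomputable def sphTanr (a b c : ℝ) : ℝ :=
  sphJ a b c / Real.sqrt (Real.sin ((a + b + c) / 2))

/-- Two factors of Heron's product for half-side sines dominate the spherical ones. -/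
theorem sin_mul_sin_le_half_side_factors {a b c : ℝ} (hb : 0 < b) (hc : 0 < c)
    (hbc : b + c < 2 * Real.pi) :
    Real.sin ((a + b - c) / 2) * Real.sin ((a + c - b) / 2) ≤
      (Real.sin (a / 2) + Real.sin (b / 2) - Real.sin (c / 2)) *
        (Real.sin (a / 2) + Real.sin (c / 2) - Real.sin (b / 2)) := by
  have hsub : Real.sin (b / 2) - Real.sin (c / 2) =
      2 * Real.sin ((b - c) / 4) * Real.cos ((b + c) / 4) := by
    rw [Real.sin_sub_sin]; ring_nf
  have hdbl : Real.sin ((b - c) / 2) =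
      2 * Real.sin ((b - c) / 4) * Real.cos ((b - c) / 4) := by
    rw [← Real.sin_two_mul]; ring_nf
  have hprod : Real.sin ((a + b - c) / 2) * Real.sin ((a + c - b) / 2) =
      Real.sin (a / 2) ^ 2 - Real.sin ((b - c) / 2) ^ 2 := by
    rw [show (a + b - c) / 2 = a / 2 + (b - c) / 2 by ring,
      show (a + c - b) / 2 = a / 2 - (b - c) / 2 by ring, Real.sin_add, Real.sin_sub]
    linear_combination Real.sin (a / 2) ^ 2 * Real.sin_sq_add_cos_sq ((b - c) / 2) -
      Real.sin ((b - c) / 2) ^ 2 * Real.sin_sq_add_cos_sq (a / 2)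
  have hcos : 0 ≤ Real.cos ((b + c) / 4) :=
    Real.cos_nonneg_of_mem_Icc ⟨by linarith, by linarith⟩
  have hle : Real.cos ((b + c) / 4) ≤ Real.cos ((b - c) / 4) := by
    rw [show (b + c) / 4 = b / 4 + c / 4 by ring, show (b - c) / 4 = b / 4 - c / 4 by ring,
      Real.cos_add, Real.cos_sub]
    have := mul_pos (Real.sin_pos_of_pos_of_lt_pi (x := b / 4) (by linarith) (by linarith))
      (Real.sin_pos_of_pos_of_lt_pi (x := c / 4) (by linarith) (by linarith))
    linarith
  have hsq : (Real.sin (b / 2) - Real.sin (c / 2)) ^ 2 ≤ Real.sin ((b - c) / 2) ^ 2 := by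
    rw [hsub, hdbl, mul_pow, mul_pow _ (Real.cos ((b - c) / 4))]
    gcongr
  rw [hprod]
  linarith

/-- If both factors have positive sum and positive product, then both are positive. -/
theorem pos_and_pos_of_add_pos_of_mul_pos {p q : ℝ} (hadd : 0 < p + q) (hmul : 0 < p * q) :
    0 < p ∧ 0 < q := by
  rcases mul_pos_iff.mp hmul with h | h
  · exact h
  · linarith [h.1, h.2]

/-- If the pairwise products of nonnegative triples are ordered, so are the full products. -/
theorem mul_mul_le_mul_mul_of_pairwise {p q r u v w : ℝ}
    (hp : 0 ≤ p) (hq : 0 ≤ q) (hr : 0 ≤ r) (hu : 0 ≤ u) (hv : 0 ≤ v) (hw : 0 ≤ w)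
    (hpq : p * q ≤ u * v) (hpr : p * r ≤ u * w) (hqr : q * r ≤ v * w) :
    p * q * r ≤ u * v * w := by
  refine (sq_le_sq₀ (by positivity) (by positivity)).mp ?_
  calc (p * q * r) ^ 2 = (p * q) * (p * r) * (q * r) := by ring
    _ ≤ (u * v) * (u * w) * (v * w) := by gcongr
    _ = (u * v * w) ^ 2 := by ring

/-- Padoa's inequality. -/
theorem padoa_inequality {x y z : ℝ} (hx : x < y + z) (hy : y < x + z) (hz : z < x + y) :
    (x + y - z) * (x + z - y) * (y + z - x) ≤ x * y * z := by
  have h : 0 ≤ x * y * z := by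
    have hx0 : 0 ≤ x := by linarith
    have hy0 : 0 ≤ y := by linarith
    have hz0 : 0 ≤ z := by linarith
    positivity
  have hp : 0 ≤ x + y - z := by linarith
  have hq : 0 ≤ x + z - y := by linarith
  have hr : 0 ≤ y + z - x := by linarith
  refine (sq_le_sq₀ (by positivity) h).mp ?_
  calc ((x + y - z) * (x + z - y) * (y + z - x)) ^ 2
      = ((x + y - z) * (x + z - y)) * ((x + y - z) * (y + z - x)) *
          ((x + z - y) * (y + z - x)) := by ring
    _ ≤ x ^ 2 * y ^ 2 * z ^ 2 := by
        gcongr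
        · linarith [sq_nonneg (y - z)]
        · linarith [sq_nonneg (x - z)]
        · linarith [sq_nonneg (x - y)]
    _ = (x * y * z) ^ 2 := by ring

/-- Generalization theorem, spherical case: if `f` and `g` are homogeneous of degree `n`,
`f(R, r) ≥ g(a, b, c)` holds for Euclidean triangles with equality iff equilateral, and
`x ↦ f (2M²/x) x` is decreasing on `(0, M]`, then for spherical triangles
`f (tan R) (tan r) ≥ 2^n · g (s a) (s b) (s c) · ((s a + s b + s c)/sin((a+b+c)/2))^(n/2)`,
with equality iff `a = b = c`, where `s x = sin (x/2)`. -/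
theorem generalization_spherical (n : ℝ) (f : ℝ → ℝ → ℝ) (g : ℝ → ℝ → ℝ → ℝ)
    (hf : ∀ l x y : ℝ, 0 < l → 0 < x → 0 < y → f (l * x) (l * y) = l ^ n * f x y)
    (hg : ∀ l x y z : ℝ, 0 < l → 0 < x → 0 < y → 0 < z →
      g (l * x) (l * y) (l * z) = l ^ n * g x y z)
    (heuc : ∀ a b c : ℝ, 0 < a → 0 < b → 0 < c → a < b + c → b < a + c → c < a + b →
      g a b c ≤ f (euclideanCircumradius a b c) (euclideanInradius a b c) ∧
      (f (euclideanCircumradius a b c) (euclideanInradius a b c) = g a b c ↔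
        a = b ∧ b = c))
    (hdec : ∀ M x₁ x₂ : ℝ, 0 < M → 0 < x₁ → x₁ ≤ x₂ → x₂ ≤ M →
      f (2 * M ^ 2 / x₂) x₂ ≤ f (2 * M ^ 2 / x₁) x₁)
    (a b c : ℝ) (ha : 0 < a) (hb : 0 < b) (hc : 0 < c)
    (habc : a < b + c) (hbac : b < a + c) (hcab : c < a + b)
    (hsum : a + b + c < 2 * Real.pi) :
    (2 : ℝ) ^ n * g (Real.sin (a / 2)) (Real.sin (b / 2)) (Real.sin (c / 2)) *
        ((Real.sin (a / 2) + Real.sin (b / 2) + Real.sin (c / 2)) /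
          Real.sin ((a + b + c) / 2)) ^ (n / 2) ≤
      f (sphTanR a b c) (sphTanr a b c) ∧
    (f (sphTanR a b c) (sphTanr a b c) =
      (2 : ℝ) ^ n * g (Real.sin (a / 2)) (Real.sin (b / 2)) (Real.sin (c / 2)) *
        ((Real.sin (a / 2) + Real.sin (b / 2) + Real.sin (c / 2)) /
          Real.sin ((a + b + c) / 2)) ^ (n / 2) ↔
      a = b ∧ b = c) := by
  have hx : 0 < Real.sin (a / 2) := Real.sin_pos_of_pos_of_lt_pi (by linarith) (by linarith)
  have hy : 0 < Real.sin (b / 2) := Real.sin_pos_of_pos_of_lt_pi (by linarith) (by linarith)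
  have hz : 0 < Real.sin (c / 2) := Real.sin_pos_of_pos_of_lt_pi (by linarith) (by linarith)
  have hS : 0 < Real.sin ((a + b + c) / 2) :=
    Real.sin_pos_of_pos_of_lt_pi (by linarith) (by linarith)
  have hC : 0 < Real.sin ((a + b - c) / 2) :=
    Real.sin_pos_of_pos_of_lt_pi (by linarith) (by linarith)
  have hB : 0 < Real.sin ((a + c - b) / 2) :=
    Real.sin_pos_of_pos_of_lt_pi (by linarith) (by linarith)
  have hA : 0 < Real.sin ((b + c - a) / 2) :=
    Real.sin_pos_of_pos_of_lt_pi (by linarith) (by linarith)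
  have hCB := sin_mul_sin_le_half_side_factors (a := a) hb hc (by linarith)
  have hCA := sin_mul_sin_le_half_side_factors (a := b) ha hc (by linarith)
  have hBA := sin_mul_sin_le_half_side_factors (a := c) ha hb (by linarith)
  rw [add_comm b a] at hCA
  rw [add_comm c a, add_comm c b] at hBA
  have hinj : Real.sin (a / 2) = Real.sin (b / 2) ∧ Real.sin (b / 2) = Real.sin (c / 2) ↔
      a = b ∧ b = c := by
    have key : ∀ u v : ℝ, 0 < u → u < Real.pi → 0 < v → v < Real.pi →
        Real.sin (u / 2) = Real.sin (v / 2) → u = v := by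
      intro u v hu hu' hv hv' h
      have := Real.injOn_sin ⟨by linarith, by linarith⟩ ⟨by linarith, by linarith⟩ h
      linarith
    constructor
    · rintro ⟨h₁, h₂⟩
      exact ⟨key a b ha (by linarith) hb (by linarith) h₁,
        key b c hb (by linarith) hc (by linarith) h₂⟩
    · rintro ⟨rfl, rfl⟩
      exact ⟨rfl, rfl⟩
  have hJ_eq : a = b ∧ b = c → sphJ a b c ^ 2 =
      (Real.sin (a / 2) + Real.sin (b / 2) - Real.sin (c / 2)) *
        (Real.sin (a / 2) + Real.sin (c / 2) - Real.sin (b / 2)) *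
        (Real.sin (b / 2) + Real.sin (c / 2) - Real.sin (a / 2)) := by
    rintro ⟨rfl, rfl⟩
    rw [sphJ, Real.sq_sqrt (by positivity)]
    ring_nf
  have hJ : 0 < sphJ a b c := by unfold sphJ; positivity
  have hJ_sq : sphJ a b c ^ 2 = Real.sin ((a + b - c) / 2) * Real.sin ((a + c - b) / 2) *
      Real.sin ((b + c - a) / 2) := Real.sq_sqrt (by positivity)
  unfold sphTanR sphTanr
  generalize sphJ a b c = J at *
  generalize Real.sin ((a + b - c) / 2) = C at *
  generalize Real.sin ((a + c - b) / 2) = B at *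
  generalize Real.sin ((b + c - a) / 2) = A at *
  generalize Real.sin ((a + b + c) / 2) = S at *
  generalize Real.sin (a / 2) = x at *
  generalize Real.sin (b / 2) = y at *
  generalize Real.sin (c / 2) = z at *
  obtain ⟨hr, hq⟩ := pos_and_pos_of_add_pos_of_mul_pos (p := x + y - z) (q := x + z - y)
    (by linarith) ((mul_pos hC hB).trans_le hCB)
  obtain ⟨-, hp⟩ := pos_and_pos_of_add_pos_of_mul_pos (p := x + y - z) (q := y + z - x)
    (by linarith) ((mul_pos hC hA).trans_le (by linarith))
  obtain ⟨hge, heq⟩ := heuc x y z hx hy hz (by linarith) (by linarith) (by linarith)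
  have hJle : J ^ 2 ≤ (x + y - z) * (x + z - y) * (y + z - x) := by
    rw [hJ_sq]
    exact mul_mul_le_mul_mul_of_pairwise hC.le hB.le hA.le hr.le hq.le hp.le hCB
      (by linarith) (by linarith)
  have hpadoa := padoa_inequality (x := x) (y := y) (z := z)
    (by linarith) (by linarith) (by linarith)
  obtain ⟨K, hK, hK_sq⟩ : ∃ K : ℝ, 0 < K ∧ K ^ 2 = (x + y - z) * (x + z - y) * (y + z - x) :=
    ⟨_, Real.sqrt_pos.mpr (by positivity), Real.sq_sqrt (by positivity)⟩
  rw [← hK_sq] at hJle hpadoa hJ_eq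
  have hJK : J ≤ K := (sq_le_sq₀ hJ.le hK.le).mp hJle
  have hP : 0 < x + y + z := by positivity
  have hR_E : euclideanCircumradius x y z = x * y * z / (√(x + y + z) * K) := by
    rw [euclideanCircumradius, show (x + y + z) * (y + z - x) * (x + z - y) * (x + y - z) =
      (x + y + z) * K ^ 2 by rw [hK_sq]; ring, Real.sqrt_mul hP.le, Real.sqrt_sq hK.le]
  have hr_E : euclideanInradius x y z = 1 / 2 * (K / √(x + y + z)) := by
    rw [euclideanInradius, show (y + z - x) * (x + z - y) * (x + y - z) = K ^ 2 by
      rw [hK_sq]; ring, Real.sqrt_div (sq_nonneg K), Real.sqrt_sq hK.le]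
  have hscale : f (2 * x * y * z / (K * √S)) (K / √S) =
      (2 : ℝ) ^ n * ((x + y + z) / S) ^ (n / 2) *
        f (euclideanCircumradius x y z) (euclideanInradius x y z) := by
    have hpow : (2 * √((x + y + z) / S)) ^ n = (2 : ℝ) ^ n * ((x + y + z) / S) ^ (n / 2) := by
      rw [Real.mul_rpow (by norm_num) (Real.sqrt_nonneg _), Real.sqrt_eq_rpow,
        ← Real.rpow_mul (by positivity)]
      ring_nf
    rw [← hpow, ← hf _ _ _ (by positivity) (by rw [hR_E]; positivity)
      (by rw [hr_E]; positivity), hR_E, hr_E, Real.sqrt_div hP.le]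
    congr 1 <;> field_simp
  have hmono : f (2 * x * y * z / (K * √S)) (K / √S) ≤ f (2 * x * y * z / (J * √S)) (J / √S) := by
    have hM : ∀ t : ℝ, 0 < t →
        2 * (√(x * y * z) / √S) ^ 2 / (t / √S) = 2 * x * y * z / (t * √S) := by
      intro t ht
      rw [div_pow, Real.sq_sqrt (by positivity)]
      field_simp
    have h := hdec (√(x * y * z) / √S) (J / √S) (K / √S) (by positivity) (by positivity)
      (by gcongr) (by gcongr; exact Real.le_sqrt_of_sq_le hpadoa)
    rwa [hM J hJ, hM K hK] at h
  have hcoef : 0 < (2 : ℝ) ^ n * ((x + y + z) / S) ^ (n / 2) := by positivity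
  rw [mul_right_comm, ← hinj, ← heq]
  rw [hscale] at hmono
  have hmul := mul_le_mul_of_nonneg_left hge hcoef.le
  refine ⟨hmul.trans hmono, fun h => ?_, fun h => ?_⟩
  · exact le_antisymm (le_of_mul_le_mul_left (hmono.trans h.le) hcoef) hge
  · have hKJ : J = K := (sq_eq_sq₀ hJ.le hK.le).mp (hJ_eq (hinj.mp (heq.mp h)))
    rw [hKJ, hscale, h]
end

section
/- Let g : ℝ → ℝ → ℝ → ℝ satisfy g(λx, λy, λz) = g(x, y, z) for all λ > 0 and all x, y, z > 0 (homogeneity of degree 0), and suppose that R_E(a,b,c)/r_E(a,b,c) ≥ g(a, b, c) holds for all positive reals a, b, c satisfying the strict triangle inequalities, with equality if and only if a = b = c. Then for all side lengths a, b, c of a spherical triangle, T_R/T_r ≥ g(s(a), s(b), s(c)). -/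
open Real in
/-- The product form of `1 - cos² a - cos² b - cos² c + 2 cos a cos b cos c` in terms of the
sines of the half-sides. -/
lemma sin_mul_sin_mul_sin_mul_sin_eq (A B C : ℝ) :
    sin (A + B + C) * (sin (A + B - C) * sin (A + C - B) * sin (B + C - A)) =
      (sin A + sin B + sin C) * ((sin A + sin B - sin C) * (sin A + sin C - sin B) *
        (sin B + sin C - sin A)) - 4 * (sin A * sin B * sin C) ^ 2 := by
  have h1 : sin (A + B + C) * sin (B + C - A) = sin (B + C) ^ 2 - sin A ^ 2 := by
    rw [show A + B + C = (B + C) + A by ring, sin_add (B + C) A, sin_sub (B + C) A]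
    linear_combination sin (B + C) ^ 2 * sin_sq_add_cos_sq A
      - sin A ^ 2 * sin_sq_add_cos_sq (B + C)
  have h2 : sin (A + B - C) * sin (A + C - B) = sin A ^ 2 - sin (B - C) ^ 2 := by
    rw [show A + B - C = A + (B - C) by ring, show A + C - B = A - (B - C) by ring,
      sin_add A (B - C), sin_sub A (B - C)]
    linear_combination sin A ^ 2 * sin_sq_add_cos_sq (B - C)
      - sin (B - C) ^ 2 * sin_sq_add_cos_sq A
  have h3 : sin (B + C) ^ 2 + sin (B - C) ^ 2 =
      2 * (sin B ^ 2 * (1 - sin C ^ 2) + sin C ^ 2 * (1 - sin B ^ 2)) := by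
    rw [sin_add, sin_sub, ← cos_sq', ← cos_sq']
    ring
  have h4 : sin (B + C) * sin (B - C) = sin B ^ 2 - sin C ^ 2 := by
    rw [sin_add, sin_sub]
    linear_combination sin B ^ 2 * sin_sq_add_cos_sq C - sin C ^ 2 * sin_sq_add_cos_sq B
  calc _ = (sin (A + B + C) * sin (B + C - A)) * (sin (A + B - C) * sin (A + C - B)) := by ring
    _ = (sin (B + C) ^ 2 + sin (B - C) ^ 2) * sin A ^ 2 - (sin (B + C) * sin (B - C)) ^ 2
        - sin A ^ 4 := by rw [h1, h2]; ring
    _ = _ := by rw [h3, h4]; ring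

open Real in
lemma sin_add_sin_add_sin_sub_sin_add (A B C : ℝ) :
    sin A + sin B + sin C - sin (A + B + C) =
      4 * (sin ((B + C) / 2) * sin ((A + C) / 2) * sin ((A + B) / 2)) := by
  have h1 : sin A + sin B = 2 * sin ((A + B) / 2) * cos ((A - B) / 2) := sin_add_sin A B
  have h2 : sin (A + B + C) - sin C = 2 * sin ((A + B) / 2) * cos ((A + B) / 2 + C) := by
    rw [sin_sub_sin]; ring_nf
  have h3 : cos ((A - B) / 2) - cos ((A + B) / 2 + C) =
      2 * sin ((A + C) / 2) * sin ((B + C) / 2) := by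
    rw [← neg_sub, cos_sub_cos]; ring_nf
  linear_combination h1 - h2 + 2 * sin ((A + B) / 2) * h3

open Real in
lemma sin_lt_sin_add_of_lt {A B C : ℝ} (hA0 : 0 < A) (hA : A < B + C)
    (hS : A + B + C < π) : sin A < sin (B + C) := by
  have h : sin (B + C) - sin A = 2 * sin ((B + C - A) / 2) * cos ((B + C + A) / 2) :=
    sin_sub_sin _ _
  have h1 := sin_pos_of_pos_of_lt_pi (x := (B + C - A) / 2) (by linarith) (by linarith)
  have h2 := cos_pos_of_mem_Ioo (x := (B + C + A) / 2) ⟨by linarith [pi_pos], by linarith⟩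
  linarith [mul_pos (mul_pos two_pos h1) h2]

open Real in
lemma sin_lt_sin_add_sin {A B C : ℝ} (hB : 0 < B) (hC : 0 < C) (hBpi : B < π) (hCpi : C < π)
    (h : sin A < sin (B + C)) : sin A < sin B + sin C := by
  rw [sin_add] at h
  nlinarith [sin_pos_of_pos_of_lt_pi hB hBpi, sin_pos_of_pos_of_lt_pi hC hCpi, cos_le_one B,
    cos_le_one C]

open Real in
lemma mul_sin_half_add_sq_le {A B C : ℝ} (hA : 0 ≤ sin A) (h : sin A ≤ sin (B + C)) :
    (sin A + sin B - sin C) * (sin A + sin C - sin B) * sin ((B + C) / 2) ^ 2 ≤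
      sin A ^ 2 * (sin B * sin C) := by
  obtain ⟨s, d, rfl, rfl⟩ : ∃ s d, B = s + d ∧ C = s - d :=
    ⟨(B + C) / 2, (B - C) / 2, by ring, by ring⟩
  rw [show s + d + (s - d) = 2 * s by ring] at *
  rw [show 2 * s / 2 = s by ring]
  have hsq : sin A ^ 2 ≤ sin (2 * s) ^ 2 := pow_le_pow_left₀ hA h 2
  have h1 : sin (s + d) * sin (s - d) = sin s ^ 2 - sin d ^ 2 := by
    rw [sin_add, sin_sub]
    linear_combination sin s ^ 2 * sin_sq_add_cos_sq d - sin d ^ 2 * sin_sq_add_cos_sq s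
  have h2 : sin (s + d) - sin (s - d) = 2 * cos s * sin d := by
    rw [sin_add, sin_sub]; ring
  have h3 : (sin A + sin (s + d) - sin (s - d)) * (sin A + sin (s - d) - sin (s + d)) =
      sin A ^ 2 - (2 * cos s * sin d) ^ 2 := by rw [← h2]; ring
  rw [h1, h3]
  rw [sin_two_mul] at hsq
  linarith [mul_le_mul_of_nonneg_left hsq (sq_nonneg (sin d))]

open Real in
/-- Comparison of the factors entering `r` for the spherical triangle with half-sides `A, B, C`
and for the Euclidean triangle with sides `sin A, sin B, sin C`. -/
lemma sin_mul_sin_mul_sin_le {A B C : ℝ} (hA : 0 < A) (hB : 0 < B) (hC : 0 < C)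
    (hABC : A < B + C) (hBAC : B < A + C) (hCAB : C < A + B) (hS : A + B + C < π) :
    sin (A + B - C) * sin (A + C - B) * sin (B + C - A) ≤
      (sin A + sin B - sin C) * (sin A + sin C - sin B) * (sin B + sin C - sin A) := by
  have hx := sin_pos_of_pos_of_lt_pi hA (by linarith)
  have hy := sin_pos_of_pos_of_lt_pi hB (by linarith)
  have hz := sin_pos_of_pos_of_lt_pi hC (by linarith)
  have kx := sin_lt_sin_add_of_lt hA hABC hS
  have ky := sin_lt_sin_add_of_lt hB hBAC (by linarith)
  have kz := sin_lt_sin_add_of_lt hC hCAB (by linarith)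
  have px := sub_pos.2 (sin_lt_sin_add_sin hB hC (by linarith) (by linarith) kx)
  have py := sub_pos.2 (sin_lt_sin_add_sin hA hC (by linarith) (by linarith) ky)
  have pz := sub_pos.2 (sin_lt_sin_add_sin hA hB (by linarith) (by linarith) kz)
  have sx := sin_pos_of_pos_of_lt_pi (x := (B + C) / 2) (by linarith) (by linarith)
  have sy := sin_pos_of_pos_of_lt_pi (x := (A + C) / 2) (by linarith) (by linarith)
  have sz := sin_pos_of_pos_of_lt_pi (x := (A + B) / 2) (by linarith) (by linarith)
  have sS := sin_pos_of_pos_of_lt_pi (x := A + B + C) (by linarith) hS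
  have e1 := sin_mul_sin_mul_sin_mul_sin_eq A B C
  have e2 := sin_add_sin_add_sin_sub_sin_add A B C
  have mx := mul_sin_half_add_sq_le hx.le kx.le
  have my := mul_sin_half_add_sq_le hy.le ky.le
  have mz := mul_sin_half_add_sq_le hz.le kz.le
  generalize sin ((B + C) / 2) = u at *
  generalize sin ((A + C) / 2) = v at *
  generalize sin ((A + B) / 2) = w at *
  generalize sin A = x at *
  generalize sin B = y at *
  generalize sin C = z at *
  generalize sin (A + B - C) * sin (A + C - B) * sin (B + C - A) = Q at *
  have qx : y + x - z = x + y - z := by ring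
  have qy : z + x - y = x + z - y := by ring
  have qz : z + y - x = y + z - x := by ring
  rw [qx] at my
  rw [qy, qz] at mz
  generalize x + y - z = r at *
  generalize x + z - y = q at *
  generalize y + z - x = p at *
  have key : r * q * p * (u * v * w) ≤ (x * y * z) ^ 2 := by
    refine le_of_sq_le_sq ?_ (by positivity)
    calc (r * q * p * (u * v * w)) ^ 2 = (r * q * u ^ 2) * (r * p * v ^ 2) * (q * p * w ^ 2) := by
          ring
      _ ≤ (x ^ 2 * (y * z)) * (y ^ 2 * (x * z)) * (z ^ 2 * (x * y)) := by gcongr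
      _ = _ := by ring
  refine le_of_mul_le_mul_left ?_ sS
  linear_combination e1 + (r * q * p) * e2 + 4 * key

lemma euclideanCircumradius_div_euclideanInradius {x y z : ℝ} (hx : 0 < x) (hy : 0 < y)
    (hz : 0 < z) (hxyz : x < y + z) (hyxz : y < x + z) (hzxy : z < x + y) :
    euclideanCircumradius x y z / euclideanInradius x y z =
      2 * (x * y * z) / ((x + y - z) * (x + z - y) * (y + z - x)) := by
  have px := sub_pos.2 hxyz
  have py := sub_pos.2 hyxz
  have pz := sub_pos.2 hzxy
  have hs : 0 < x + y + z := by positivity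
  have h : √((x + y + z) * (y + z - x) * (x + z - y) * (x + y - z)) *
      √((y + z - x) * (x + z - y) * (x + y - z) / (x + y + z)) =
      (x + y - z) * (x + z - y) * (y + z - x) := by
    rw [← Real.sqrt_mul (by positivity), ← Real.sqrt_sq (by positivity :
      0 ≤ (x + y - z) * (x + z - y) * (y + z - x))]
    congr 1
    field_simp
  rw [euclideanCircumradius, euclideanInradius, ← h, div_div, mul_left_comm, ← div_div]
  field_simp

lemma sphTanR_div_sphTanr {a b c : ℝ} (hs : 0 < Real.sin ((a + b + c) / 2))
    (hJ : 0 ≤ Real.sin ((a + b - c) / 2) * Real.sin ((a + c - b) / 2) *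
      Real.sin ((b + c - a) / 2)) :
    sphTanR a b c / sphTanr a b c =
      2 * (Real.sin (a / 2) * Real.sin (b / 2) * Real.sin (c / 2)) /
        (Real.sin ((a + b - c) / 2) * Real.sin ((a + c - b) / 2) *
          Real.sin ((b + c - a) / 2)) := by
  have h := Real.sqrt_pos.2 hs
  rw [← Real.sq_sqrt hJ, sphTanR, sphTanr, ← sphJ]
  field_simp

/-- If `g` is homogeneous of degree 0 and `R/r ≥ g (a, b, c)` holds for all Euclidean
triangles with equality iff equilateral, then `tan R / tan r ≥ g (s a) (s b) (s c)`
holds for all spherical triangles, where `s x = sin (x/2)`. -/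
theorem spherical_Rr_transfer (g : ℝ → ℝ → ℝ → ℝ)
    (hg : ∀ l x y z : ℝ, 0 < l → 0 < x → 0 < y → 0 < z →
      g (l * x) (l * y) (l * z) = g x y z)
    (heuc : ∀ a b c : ℝ, 0 < a → 0 < b → 0 < c → a < b + c → b < a + c → c < a + b →
      g a b c ≤ euclideanCircumradius a b c / euclideanInradius a b c ∧
      (euclideanCircumradius a b c / euclideanInradius a b c = g a b c ↔
        a = b ∧ b = c))
    (a b c : ℝ) (ha : 0 < a) (hb : 0 < b) (hc : 0 < c)
    (habc : a < b + c) (hbac : b < a + c) (hcab : c < a + b)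
    (hsum : a + b + c < 2 * Real.pi) :
    g (Real.sin (a / 2)) (Real.sin (b / 2)) (Real.sin (c / 2)) ≤
      sphTanR a b c / sphTanr a b c := by
  have sab := Real.sin_pos_of_pos_of_lt_pi (x := (a + b - c) / 2) (by linarith) (by linarith)
  have sac := Real.sin_pos_of_pos_of_lt_pi (x := (a + c - b) / 2) (by linarith) (by linarith)
  have sbc := Real.sin_pos_of_pos_of_lt_pi (x := (b + c - a) / 2) (by linarith) (by linarith)
  have sS := Real.sin_pos_of_pos_of_lt_pi (x := (a + b + c) / 2) (by linarith) (by linarith)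
  have hx := Real.sin_pos_of_pos_of_lt_pi (x := a / 2) (by linarith) (by linarith)
  have hy := Real.sin_pos_of_pos_of_lt_pi (x := b / 2) (by linarith) (by linarith)
  have hz := Real.sin_pos_of_pos_of_lt_pi (x := c / 2) (by linarith) (by linarith)
  have tx : Real.sin (a / 2) < Real.sin (b / 2) + Real.sin (c / 2) :=
    sin_lt_sin_add_sin (by linarith) (by linarith) (by linarith) (by linarith)
      (sin_lt_sin_add_of_lt (by linarith) (by linarith) (by linarith))
  have ty : Real.sin (b / 2) < Real.sin (a / 2) + Real.sin (c / 2) :=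
    sin_lt_sin_add_sin (by linarith) (by linarith) (by linarith) (by linarith)
      (sin_lt_sin_add_of_lt (by linarith) (by linarith) (by linarith))
  have tz : Real.sin (c / 2) < Real.sin (a / 2) + Real.sin (b / 2) :=
    sin_lt_sin_add_sin (by linarith) (by linarith) (by linarith) (by linarith)
      (sin_lt_sin_add_of_lt (by linarith) (by linarith) (by linarith))
  have hle := sin_mul_sin_mul_sin_le (A := a / 2) (B := b / 2) (C := c / 2) (by linarith)
    (by linarith) (by linarith) (by linarith) (by linarith) (by linarith) (by linarith)
  rw [← add_div, ← add_div, ← add_div, ← sub_div, ← sub_div, ← sub_div] at hle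
  refine (heuc _ _ _ hx hy hz tx ty tz).1.trans ?_
  rw [euclideanCircumradius_div_euclideanInradius hx hy hz tx ty tz,
    sphTanR_div_sphTanr sS (by positivity)]
  exact div_le_div_of_nonneg_left (by positivity) (by positivity) hle
end

section
/- If a, b, c are the side lengths of a hyperbolic triangle, then (s(a)² + s(b)² + s(c)²)·((s(a)+s(b)+s(c))/sinh((a+b+c)/2)) ≥ 3·T_r·(2·T_R − T_r), with equality if and only if a = b = c. -/
/-- The quantity `J` of a hyperbolic triangle with side lengths `a, b, c`. -/
noncomputable def hypJ (a b c : ℝ) : ℝ :=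
  Real.sqrt (Real.sinh ((a + b - c) / 2) * Real.sinh ((a + c - b) / 2) *
    Real.sinh ((b + c - a) / 2))

/-- `tanh R` for the circumradius `R` of a hyperbolic triangle with side lengths `a, b, c`. -/
noncomputable def hypTanhR (a b c : ℝ) : ℝ :=
  2 * Real.sinh (a / 2) * Real.sinh (b / 2) * Real.sinh (c / 2) /
    (hypJ a b c * Real.sqrt (Real.sinh ((a + b + c) / 2)))

/-- `tanh r` for the inradius `r` of a hyperbolic triangle with side lengths `a, b, c`. -/
noncomputable def hypTanhr (a b c : ℝ) : ℝ :=
  hypJ a b c / Real.sqrt (Real.sinh ((a + b + c) / 2))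

/-- Schur's inequality of degree one, with its equality case for positive reals. -/
theorem schur_one_pos {x y z : ℝ} (hx : 0 < x) (hy : 0 < y) (hz : 0 < z) :
    0 ≤ x * (x - y) * (x - z) + y * (y - x) * (y - z) + z * (z - x) * (z - y) ∧
    (x * (x - y) * (x - z) + y * (y - x) * (y - z) + z * (z - x) * (z - y) = 0 →
      x = y ∧ y = z) := by
  have ordered : ∀ {p q r : ℝ}, 0 < p → 0 < q → 0 < r → p ≤ q → q ≤ r →
      0 ≤ p * (p - q) * (p - r) + q * (q - p) * (q - r) + r * (r - p) * (r - q) ∧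
      (p * (p - q) * (p - r) + q * (q - p) * (q - r) + r * (r - p) * (r - q) = 0 →
        p = q ∧ q = r) := by
    intro p q r hp hq hr hpq hqr
    have e : p * (p - q) * (p - r) + q * (q - p) * (q - r) + r * (r - p) * (r - q) =
        p * ((q - p) * (r - p)) + (r - q) ^ 2 * (r + q - p) := by ring
    have h₁ : 0 ≤ p * ((q - p) * (r - p)) :=
      mul_nonneg hp.le (mul_nonneg (by linarith) (by linarith))
    have hpos : 0 < r + q - p := by linarith
    have h₂ : 0 ≤ (r - q) ^ 2 * (r + q - p) := mul_nonneg (sq_nonneg _) hpos.le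
    rw [e]
    refine ⟨add_nonneg h₁ h₂, fun h => ?_⟩
    have h₃ : (r - q) ^ 2 * (r + q - p) = 0 := by linarith
    have hrq : r - q = 0 := by simpa [hpos.ne'] using h₃
    obtain rfl : r = q := by linarith
    have h₄ : p * ((r - p) * (r - p)) = 0 := by linarith
    have hrp : r - p = 0 := by simpa [hp.ne'] using h₄
    exact ⟨by linarith, rfl⟩
  rcases le_total x y with h₁ | h₁ <;> rcases le_total y z with h₂ | h₂ <;>
    rcases le_total x z with h₃ | h₃
  · exact ordered hx hy hz h₁ h₂
  · exact ordered hx hy hz h₁ h₂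
  · have := ordered hx hz hy h₃ h₂
    exact ⟨by linarith, fun h => by have := this.2 (by linarith); grind⟩
  · have := ordered hz hx hy h₃ h₁
    exact ⟨by linarith, fun h => by have := this.2 (by linarith); grind⟩
  · have := ordered hy hx hz h₁ h₃
    exact ⟨by linarith, fun h => by have := this.2 (by linarith); grind⟩
  · have := ordered hy hz hx h₂ h₃
    exact ⟨by linarith, fun h => by have := this.2 (by linarith); grind⟩
  · have := ordered hz hy hx h₂ h₁
    exact ⟨by linarith, fun h => by have := this.2 (by linarith); grind⟩
  · have := ordered hz hy hx h₂ h₁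
    exact ⟨by linarith, fun h => by have := this.2 (by linarith); grind⟩

/-- Chebyshev's sum inequality for three terms. -/
theorem chebyshev_three {x y z p q r : ℝ} (h₁ : 0 ≤ (x - y) * (p - q))
    (h₂ : 0 ≤ (y - z) * (q - r)) (h₃ : 0 ≤ (x - z) * (p - r)) :
    (x + y + z) * (p + q + r) ≤ 3 * (x * p + y * q + z * r) := by
  linarith

theorem nine_mul_prod_le {p q r : ℝ} (hp : 0 < p) (hq : 0 < q) (hr : 0 < r) :
    9 * (p * q * r) ≤ (p ^ 2 + q ^ 2 + r ^ 2) * (p + q + r) := by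
  nlinarith [mul_nonneg hp.le (sq_nonneg (q - r)), mul_nonneg hq.le (sq_nonneg (p - r)),
    mul_nonneg hr.le (sq_nonneg (p - q)), mul_nonneg hp.le (sq_nonneg (p - r)),
    mul_nonneg hp.le (sq_nonneg (p - q)), mul_nonneg hq.le (sq_nonneg (p - q)),
    mul_nonneg hq.le (sq_nonneg (q - r)), mul_nonneg hr.le (sq_nonneg (p - r)),
    mul_nonneg hr.le (sq_nonneg (q - r))]

/-- On the unit circle's positive quadrant, the second coordinate decreases with the first. -/
theorem sub_mul_sub_nonneg_of_sq_add_sq {t u k l : ℝ} (ht : 0 < t) (hu : 0 < u) (hk : 0 < k)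
    (hl : 0 < l) (h₁ : k ^ 2 + t ^ 2 = 1) (h₂ : l ^ 2 + u ^ 2 = 1) :
    0 ≤ (u - t) * (k - l) := by
  have h : (u - t) * (k - l) * (k + l) = (u - t) ^ 2 * (u + t) := by
    linear_combination (u - t) * (h₁ - h₂)
  have h' : 0 ≤ (u - t) * (k - l) * (k + l) := by rw [h]; positivity
  exact nonneg_of_mul_nonneg_left h' (by positivity)

/-- Comparison of the weighted and the unweighted sums for weights `k, l, m` on the unit circle. -/
theorem weighted_sum_ge {t u v k l m : ℝ} (ht : 0 < t) (hu : 0 < u) (hv : 0 < v)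
    (hk : 0 < k) (hl : 0 < l) (hm : 0 < m)
    (h₁ : k ^ 2 + t ^ 2 = 1) (h₂ : l ^ 2 + u ^ 2 = 1) (h₃ : m ^ 2 + v ^ 2 = 1) :
    k * l * m * (((u + v) ^ 2 + (t + v) ^ 2 + (t + u) ^ 2) * ((u + v) + (t + v) + (t + u))) ≤
      (((u + v) * k) ^ 2 + ((t + v) * l) ^ 2 + ((t + u) * m) ^ 2) *
        ((u + v) * k + (t + v) * l + (t + u) * m) := by
  have square_term : ∀ {p q n i j : ℝ}, 0 < p → 0 < q → 0 < n → i ^ 2 + p ^ 2 = 1 →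
      j ^ 2 + q ^ 2 = 1 → 0 ≤ ((q + n) ^ 2 - (p + n) ^ 2) * (i ^ 2 - j ^ 2) := by
    intro p q n i j hp hq hn hi hj
    have e : ((q + n) ^ 2 - (p + n) ^ 2) * (i ^ 2 - j ^ 2) =
        (q - p) ^ 2 * ((q + p + 2 * n) * (q + p)) := by
      linear_combination ((q + n) ^ 2 - (p + n) ^ 2) * (hi - hj)
    rw [e]; positivity
  have c₁ : ((u + v) + (t + v) + (t + u)) * (k + l + m) ≤
      3 * ((u + v) * k + (t + v) * l + (t + u) * m) := by
    apply chebyshev_three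
    · linarith [sub_mul_sub_nonneg_of_sq_add_sq ht hu hk hl h₁ h₂]
    · linarith [sub_mul_sub_nonneg_of_sq_add_sq hu hv hl hm h₂ h₃]
    · linarith [sub_mul_sub_nonneg_of_sq_add_sq ht hv hk hm h₁ h₃]
  have c₂ : ((u + v) ^ 2 + (t + v) ^ 2 + (t + u) ^ 2) * (k ^ 2 + l ^ 2 + m ^ 2) ≤
      3 * ((u + v) ^ 2 * k ^ 2 + (t + v) ^ 2 * l ^ 2 + (t + u) ^ 2 * m ^ 2) := by
    apply chebyshev_three
    · exact square_term ht hu hv h₁ h₂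
    · linarith [square_term hu hv ht h₂ h₃]
    · linarith [square_term ht hv hu h₁ h₃]
  have c₃ := nine_mul_prod_le hk hl hm
  have c₄ := mul_le_mul c₂ c₁ (by positivity) (by positivity)
  have c₅ := mul_le_mul_of_nonneg_left c₃
    (show 0 ≤ ((u + v) ^ 2 + (t + v) ^ 2 + (t + u) ^ 2) * ((u + v) + (t + v) + (t + u)) by
      positivity)
  linarith

theorem tanh_form {t u v k l m : ℝ} (ht : 0 < t) (hu : 0 < u) (hv : 0 < v)
    (hk : 0 < k) (hl : 0 < l) (hm : 0 < m)
    (h₁ : k ^ 2 + t ^ 2 = 1) (h₂ : l ^ 2 + u ^ 2 = 1) (h₃ : m ^ 2 + v ^ 2 = 1) :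
    0 ≤ (((u + v) * k) ^ 2 + ((t + v) * l) ^ 2 + ((t + u) * m) ^ 2) *
        ((u + v) * k + (t + v) * l + (t + u) * m) -
      k * l * m * (3 * (4 * ((u + v) * (t + v) * (t + u)) - 8 * (t * u * v))) ∧
    ((((u + v) * k) ^ 2 + ((t + v) * l) ^ 2 + ((t + u) * m) ^ 2) *
        ((u + v) * k + (t + v) * l + (t + u) * m) -
      k * l * m * (3 * (4 * ((u + v) * (t + v) * (t + u)) - 8 * (t * u * v))) = 0 →
      t = u ∧ u = v) := by
  have hw := weighted_sum_ge ht hu hv hk hl hm h₁ h₂ h₃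
  obtain ⟨hs, hs'⟩ := schur_one_pos ht hu hv
  have hklm : 0 < k * l * m := by positivity
  have hm' := mul_nonneg hklm.le hs
  refine ⟨by linarith, fun h => hs' ?_⟩
  have h0 : k * l * m *
      (t * (t - u) * (t - v) + u * (u - t) * (u - v) + v * (v - t) * (v - u)) = 0 :=
    le_antisymm (by linarith) hm'
  exact (mul_eq_zero.mp h0).resolve_left hklm.ne'

/-- The inequality for the sides `y + z`, `x + z`, `x + y` (half-lengths), cleared of the factor
`sinh` of the semiperimeter. -/
theorem sinh_ravi_form {x y z : ℝ} (hx : 0 < x) (hy : 0 < y) (hz : 0 < z) :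
    3 * (4 * (Real.sinh (y + z) * Real.sinh (x + z) * Real.sinh (x + y)) -
        Real.sinh (2 * x) * Real.sinh (2 * y) * Real.sinh (2 * z)) ≤
      (Real.sinh (y + z) ^ 2 + Real.sinh (x + z) ^ 2 + Real.sinh (x + y) ^ 2) *
        (Real.sinh (y + z) + Real.sinh (x + z) + Real.sinh (x + y)) ∧
    ((Real.sinh (y + z) ^ 2 + Real.sinh (x + z) ^ 2 + Real.sinh (x + y) ^ 2) *
        (Real.sinh (y + z) + Real.sinh (x + z) + Real.sinh (x + y)) =
      3 * (4 * (Real.sinh (y + z) * Real.sinh (x + z) * Real.sinh (x + y)) -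
        Real.sinh (2 * x) * Real.sinh (2 * y) * Real.sinh (2 * z)) → x = y ∧ y = z) := by
  have circle : ∀ w : ℝ, (Real.cosh w)⁻¹ ^ 2 + Real.tanh w ^ 2 = 1 := by
    intro w
    have hc := Real.cosh_pos w
    have h := Real.cosh_sq w
    rw [Real.tanh_eq_sinh_div_cosh]
    field_simp
    linarith
  have tanh_pos : ∀ {w : ℝ}, 0 < w → 0 < Real.tanh w := fun {w} hw => by
    rw [Real.tanh_eq_sinh_div_cosh]
    exact div_pos (Real.sinh_pos_iff.mpr hw) (Real.cosh_pos w)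
  obtain ⟨h, h'⟩ := tanh_form (tanh_pos hx) (tanh_pos hy) (tanh_pos hz)
    (inv_pos.mpr (Real.cosh_pos x)) (inv_pos.mpr (Real.cosh_pos y))
    (inv_pos.mpr (Real.cosh_pos z)) (circle x) (circle y) (circle z)
  have hcx := Real.cosh_pos x
  have hcy := Real.cosh_pos y
  have hcz := Real.cosh_pos z
  set D := (((Real.tanh y + Real.tanh z) * (Real.cosh x)⁻¹) ^ 2 +
      ((Real.tanh x + Real.tanh z) * (Real.cosh y)⁻¹) ^ 2 +
      ((Real.tanh x + Real.tanh y) * (Real.cosh z)⁻¹) ^ 2) *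
        ((Real.tanh y + Real.tanh z) * (Real.cosh x)⁻¹ +
        (Real.tanh x + Real.tanh z) * (Real.cosh y)⁻¹ +
        (Real.tanh x + Real.tanh y) * (Real.cosh z)⁻¹) -
      (Real.cosh x)⁻¹ * (Real.cosh y)⁻¹ * (Real.cosh z)⁻¹ *
        (3 * (4 * ((Real.tanh y + Real.tanh z) * (Real.tanh x + Real.tanh z) *
          (Real.tanh x + Real.tanh y)) - 8 * (Real.tanh x * Real.tanh y * Real.tanh z)))
    with hD
  have key : (Real.sinh (y + z) ^ 2 + Real.sinh (x + z) ^ 2 + Real.sinh (x + y) ^ 2) *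
        (Real.sinh (y + z) + Real.sinh (x + z) + Real.sinh (x + y)) -
      3 * (4 * (Real.sinh (y + z) * Real.sinh (x + z) * Real.sinh (x + y)) -
        Real.sinh (2 * x) * Real.sinh (2 * y) * Real.sinh (2 * z)) =
      D * (Real.cosh x * Real.cosh y * Real.cosh z) ^ 3 := by
    rw [hD]
    simp only [Real.tanh_eq_sinh_div_cosh, Real.sinh_add, Real.sinh_two_mul]
    field_simp
    ring
  have hC : 0 < (Real.cosh x * Real.cosh y * Real.cosh z) ^ 3 := by positivity
  refine ⟨by linarith [mul_nonneg h hC.le], fun heq => ?_⟩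
  have h0 : D * (Real.cosh x * Real.cosh y * Real.cosh z) ^ 3 = 0 := by linarith
  obtain ⟨e₁, e₂⟩ := h' ((mul_eq_zero.mp h0).resolve_right hC.ne')
  exact ⟨Real.tanh_injective e₁, Real.tanh_injective e₂⟩

/-- The product of `tanh r` and `2 tanh R - tanh r`, with the square roots cleared. -/
theorem hypTanhr_mul_two_hypTanhR_sub {a b c : ℝ} (ha : 0 < a) (hb : 0 < b) (hc : 0 < c)
    (habc : a < b + c) (hbac : b < a + c) (hcab : c < a + b) :
    3 * hypTanhr a b c * (2 * hypTanhR a b c - hypTanhr a b c) =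
      3 * (4 * (Real.sinh (a / 2) * Real.sinh (b / 2) * Real.sinh (c / 2)) -
        Real.sinh ((b + c - a) / 2) * Real.sinh ((a + c - b) / 2) *
          Real.sinh ((a + b - c) / 2)) / Real.sinh ((a + b + c) / 2) := by
  have hS : 0 < Real.sinh ((a + b + c) / 2) := Real.sinh_pos_iff.mpr (by linarith)
  have h₁ : 0 < Real.sinh ((a + b - c) / 2) := Real.sinh_pos_iff.mpr (by linarith)
  have h₂ : 0 < Real.sinh ((a + c - b) / 2) := Real.sinh_pos_iff.mpr (by linarith)
  have h₃ : 0 < Real.sinh ((b + c - a) / 2) := Real.sinh_pos_iff.mpr (by linarith)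
  have hP := mul_pos (mul_pos h₁ h₂) h₃
  have hJ : 0 < hypJ a b c := Real.sqrt_pos.mpr hP
  have hJ2 : hypJ a b c ^ 2 = _ := Real.sq_sqrt hP.le
  have hQ := Real.sqrt_pos.mpr hS
  have hQ2 := Real.sq_sqrt hS.le
  rw [hypTanhr, hypTanhR]
  generalize hypJ a b c = J at *
  generalize √(Real.sinh ((a + b + c) / 2)) = Q at *
  rw [← hQ2]
  field_simp
  rw [hJ2]
  ring

/-- For a hyperbolic triangle with side lengths `a, b, c` and `s x = sinh (x/2)`,
`(s a² + s b² + s c²)·((s a + s b + s c)/sinh((a+b+c)/2)) ≥ 3 tanh r (2 tanh R − tanh r)`,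
with equality iff `a = b = c`. -/
theorem hyperbolic_ineq2_right (a b c : ℝ)
    (ha : 0 < a) (hb : 0 < b) (hc : 0 < c)
    (habc : a < b + c) (hbac : b < a + c) (hcab : c < a + b) :
    3 * hypTanhr a b c * (2 * hypTanhR a b c - hypTanhr a b c) ≤
      (Real.sinh (a / 2) ^ 2 + Real.sinh (b / 2) ^ 2 + Real.sinh (c / 2) ^ 2) *
        ((Real.sinh (a / 2) + Real.sinh (b / 2) + Real.sinh (c / 2)) /
          Real.sinh ((a + b + c) / 2)) ∧
    ((Real.sinh (a / 2) ^ 2 + Real.sinh (b / 2) ^ 2 + Real.sinh (c / 2) ^ 2) *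
        ((Real.sinh (a / 2) + Real.sinh (b / 2) + Real.sinh (c / 2)) /
          Real.sinh ((a + b + c) / 2)) =
      3 * hypTanhr a b c * (2 * hypTanhR a b c - hypTanhr a b c) ↔
      a = b ∧ b = c) := by
  have hS : 0 < Real.sinh ((a + b + c) / 2) := Real.sinh_pos_iff.mpr (by linarith)
  obtain ⟨h, h'⟩ := sinh_ravi_form (x := (b + c - a) / 4) (y := (a + c - b) / 4)
    (z := (a + b - c) / 4) (by linarith) (by linarith) (by linarith)
  rw [show (a + c - b) / 4 + (a + b - c) / 4 = a / 2 by ring,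
    show (b + c - a) / 4 + (a + b - c) / 4 = b / 2 by ring,
    show (b + c - a) / 4 + (a + c - b) / 4 = c / 2 by ring,
    show 2 * ((b + c - a) / 4) = (b + c - a) / 2 by ring,
    show 2 * ((a + c - b) / 4) = (a + c - b) / 2 by ring,
    show 2 * ((a + b - c) / 4) = (a + b - c) / 2 by ring] at h h'
  rw [hypTanhr_mul_two_hypTanhR_sub ha hb hc habc hbac hcab, ← mul_div_assoc,
    div_le_div_iff_of_pos_right hS, div_left_inj' hS.ne']
  refine ⟨h, fun heq => ?_, ?_⟩
  · obtain ⟨e₁, e₂⟩ := h' heq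
    exact ⟨by linarith, by linarith⟩
  · rintro ⟨rfl, rfl⟩
    rw [add_sub_cancel_right]
    ring
end

section
/- If a, b, c are the side lengths of a spherical triangle, then 1/T_r² ≥ (1/s(a)² + 1/s(b)² + 1/s(c)²)·(sin((a+b+c)/2)/(s(a)+s(b)+s(c))), with equality if and only if a = b = c. -/
open Real in
/-- The sines of the half-excesses of two sides over the third multiply to a difference of squares. -/
theorem sin_half_add_sub_mul (a b c : ℝ) :
    sin ((a + b - c) / 2) * sin ((a + c - b) / 2) = sin (a / 2) ^ 2 - sin ((b - c) / 2) ^ 2 := by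
  rw [show (a + b - c) / 2 = a / 2 + (b - c) / 2 by ring,
    show (a + c - b) / 2 = a / 2 - (b - c) / 2 by ring, sin_add, sin_sub]
  linear_combination sin (a / 2) ^ 2 * sin_sq_add_cos_sq ((b - c) / 2) -
    sin ((b - c) / 2) ^ 2 * sin_sq_add_cos_sq (a / 2)

open Real in
theorem sin_half_add_sub_add_le (a b c : ℝ) (ha : 0 ≤ sin (a / 2)) :
    sin ((a + b - c) / 2) + sin ((a + c - b) / 2) ≤ 2 * sin (a / 2) := by
  rw [show (a + b - c) / 2 = a / 2 + (b - c) / 2 by ring,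
    show (a + c - b) / 2 = a / 2 - (b - c) / 2 by ring, sin_add, sin_sub]
  nlinarith [mul_le_mul_of_nonneg_left (cos_le_one ((b - c) / 2)) ha]

theorem eq_of_sin_half_sub_eq_zero {b c : ℝ} (h₁ : -(2 * Real.pi) < b - c)
    (h₂ : b - c < 2 * Real.pi) (h : Real.sin ((b - c) / 2) = 0) : b = c := by
  have := (Real.sin_eq_zero_iff_of_lt_of_lt (by linarith) (by linarith)).1 h
  linarith

theorem sum_inv_sq_mul_div_le {x y z u v w S : ℝ} (hx : 0 < x) (hy : 0 < y) (hz : 0 < z)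
    (hu : 0 < u) (hv : 0 < v) (hw : 0 < w) (hS : 0 < S)
    (hxuv : u * v ≤ x ^ 2) (hyuw : u * w ≤ y ^ 2) (hzvw : v * w ≤ z ^ 2)
    (hsum : u + v + w ≤ x + y + z) :
    (1 / x ^ 2 + 1 / y ^ 2 + 1 / z ^ 2) * (S / (x + y + z)) ≤ S / (u * v * w) ∧
      (S / (u * v * w) = (1 / x ^ 2 + 1 / y ^ 2 + 1 / z ^ 2) * (S / (x + y + z)) →
        u * v = x ^ 2 ∧ u * w = y ^ 2) := by
  have h₁ := one_div_le_one_div_of_le (mul_pos hu hv) hxuv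
  have h₂ := one_div_le_one_div_of_le (mul_pos hu hw) hyuw
  have h₃ := one_div_le_one_div_of_le (mul_pos hv hw) hzvw
  have hpos : 0 < S / (x + y + z) := by positivity
  have key : (1 / (u * v) + 1 / (u * w) + 1 / (v * w)) * (S / (x + y + z)) ≤
      S / (u * v * w) := by
    have : (1 / (u * v) + 1 / (u * w) + 1 / (v * w)) * (S / (x + y + z)) =
        S / (u * v * w) * ((u + v + w) / (x + y + z)) := by
      field_simp
      ring
    rw [this]
    exact mul_le_of_le_one_right (by positivity) ((div_le_one (by positivity)).2 hsum)
  refine ⟨(mul_le_mul_of_nonneg_right (by linarith) hpos.le).trans key, fun h => ?_⟩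
  have hle := le_of_mul_le_mul_right (key.trans_eq h) hpos
  have e₁ : 1 / (u * v) = 1 / x ^ 2 := by linarith
  have e₂ : 1 / (u * w) = 1 / y ^ 2 := by linarith
  simp only [one_div, inv_inj] at e₁ e₂
  exact ⟨e₁, e₂⟩

/-- For a spherical triangle with side lengths `a, b, c` and `s x = sin (x/2)`,
`1/tan² r ≥ (1/s a² + 1/s b² + 1/s c²)·(sin((a+b+c)/2)/(s a + s b + s c))`,
with equality iff `a = b = c`. -/
theorem spherical_ineq3_left (a b c : ℝ)
    (ha : 0 < a) (hb : 0 < b) (hc : 0 < c)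
    (habc : a < b + c) (hbac : b < a + c) (hcab : c < a + b)
    (hsum : a + b + c < 2 * Real.pi) :
    (1 / Real.sin (a / 2) ^ 2 + 1 / Real.sin (b / 2) ^ 2 + 1 / Real.sin (c / 2) ^ 2) *
        (Real.sin ((a + b + c) / 2) /
          (Real.sin (a / 2) + Real.sin (b / 2) + Real.sin (c / 2))) ≤
      1 / sphTanr a b c ^ 2 ∧
    (1 / sphTanr a b c ^ 2 =
      (1 / Real.sin (a / 2) ^ 2 + 1 / Real.sin (b / 2) ^ 2 + 1 / Real.sin (c / 2) ^ 2) *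
        (Real.sin ((a + b + c) / 2) /
          (Real.sin (a / 2) + Real.sin (b / 2) + Real.sin (c / 2))) ↔
      a = b ∧ b = c) := by
  have pos : ∀ t : ℝ, 0 < t → t < 2 * Real.pi → 0 < Real.sin (t / 2) := fun t h₁ h₂ =>
    Real.sin_pos_of_pos_of_lt_pi (by linarith) (by linarith)
  have hx := pos a ha (by linarith)
  have hy := pos b hb (by linarith)
  have hz := pos c hc (by linarith)
  have hu := pos (a + b - c) (by linarith) (by linarith)
  have hv := pos (a + c - b) (by linarith) (by linarith)
  have hw := pos (b + c - a) (by linarith) (by linarith)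
  have hS := pos (a + b + c) (by linarith) hsum
  have pa := sin_half_add_sub_mul a b c
  have pb := sin_half_add_sub_mul b a c
  have pc := sin_half_add_sub_mul c a b
  have qa := sin_half_add_sub_add_le a b c hx.le
  have qb := sin_half_add_sub_add_le b a c hy.le
  have qc := sin_half_add_sub_add_le c a b hz.le
  rw [add_comm b a] at pb qb
  rw [add_comm c a, add_comm c b] at pc qc
  have hT : 1 / sphTanr a b c ^ 2 = Real.sin ((a + b + c) / 2) /
      (Real.sin ((a + b - c) / 2) * Real.sin ((a + c - b) / 2) *
        Real.sin ((b + c - a) / 2)) := by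
    rw [sphTanr, sphJ, div_pow, Real.sq_sqrt (by positivity), Real.sq_sqrt hS.le, one_div_div]
  rw [hT]
  obtain ⟨hle, heq⟩ := sum_inv_sq_mul_div_le hx hy hz hu hv hw hS
    (by nlinarith [sq_nonneg (Real.sin ((b - c) / 2))])
    (by nlinarith [sq_nonneg (Real.sin ((a - c) / 2))])
    (by nlinarith [sq_nonneg (Real.sin ((a - b) / 2))]) (by linarith)
  refine ⟨hle, fun h => ?_, ?_⟩
  · obtain ⟨e₁, e₂⟩ := heq h
    have hbc : b = c := eq_of_sin_half_sub_eq_zero (by linarith) (by linarith)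
      (pow_eq_zero_iff two_ne_zero |>.1 (by linarith))
    have hac : a = c := eq_of_sin_half_sub_eq_zero (by linarith) (by linarith)
      (pow_eq_zero_iff two_ne_zero |>.1 (by linarith))
    exact ⟨hac.trans hbc.symm, hbc⟩
  · rintro ⟨rfl, rfl⟩
    simp only [add_sub_cancel_right]
    field_simp
end

section
/- If a, b, c are the side lengths of a spherical triangle, then (1/3)·(1/s(a) + 1/s(b) + 1/s(c))²·(sin((a+b+c)/2)/(s(a)+s(b)+s(c))) ≥ 2/(T_r·T_R), with equality if and only if a = b = c. (The same statement holds in hyperbolic geometry: if a, b, c are the side lengths of a hyperbolic triangle, with s(x) = sinh(x/2), J = √(sinh((a+b−c)/2)·sinh((a+c−b)/2)·sinh((b+c−a)/2)), T_R = 2·s(a)·s(b)·s(c)/(J·√(sinh((a+b+c)/2))) and T_r = J/√(sinh((a+b+c)/2)), then (1/3)·(1/s(a) + 1/s(b) + 1/s(c))²·(sinh((a+b+c)/2)/(s(a)+s(b)+s(c))) ≥ 2/(T_r·T_R), with equality if and only if a = b = c.) -/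
/-- For positive reals, `(1/3)·(1/x + 1/y + 1/z)²·(S/(x + y + z)) ≥ S/(xyz)`, with equality
iff `x = y = z`. -/
theorem div_mul_le_third_mul_sq_sum_inv {x y z S : ℝ} (hx : 0 < x) (hy : 0 < y) (hz : 0 < z)
    (hS : 0 < S) :
    S / (x * y * z) ≤ 1 / 3 * (1 / x + 1 / y + 1 / z) ^ 2 * (S / (x + y + z)) ∧
    (1 / 3 * (1 / x + 1 / y + 1 / z) ^ 2 * (S / (x + y + z)) = S / (x * y * z) ↔
      x = y ∧ y = z) := by
  have key : 1 / 3 * (1 / x + 1 / y + 1 / z) ^ 2 * (S / (x + y + z)) - S / (x * y * z) =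
      S / (6 * (x * y * z) ^ 2 * (x + y + z)) *
        ((z * (x - y)) ^ 2 + (x * (y - z)) ^ 2 + (y * (z - x)) ^ 2) := by
    field_simp
    ring
  have hpos : 0 < S / (6 * (x * y * z) ^ 2 * (x + y + z)) := by positivity
  refine ⟨?_, fun h => ?_, ?_⟩
  · rw [← sub_nonneg, key]
    positivity
  · rw [← sub_eq_zero, key, mul_eq_zero, or_iff_right hpos.ne'] at h
    have hxy : (z * (x - y)) ^ 2 = 0 := by
      nlinarith [sq_nonneg (z * (x - y)), sq_nonneg (x * (y - z)), sq_nonneg (y * (z - x))]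
    have hyz : (x * (y - z)) ^ 2 = 0 := by
      nlinarith [sq_nonneg (z * (x - y)), sq_nonneg (x * (y - z)), sq_nonneg (y * (z - x))]
    simp only [pow_eq_zero_iff two_ne_zero, mul_eq_zero, hx.ne', hz.ne', false_or,
      sub_eq_zero] at hxy hyz
    exact ⟨hxy, hyz⟩
  · rintro ⟨rfl, rfl⟩
    rw [← sub_eq_zero, key]
    simp

/-- If `J ≠ 0` and `S > 0`, then `2 / ((J/√S)·(2xyz/(J√S))) = S/(xyz)`. -/
theorem two_div_div_sqrt_mul_div_mul_sqrt {J S : ℝ} (x y z : ℝ) (hJ : J ≠ 0) (hS : 0 < S) :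
    2 / (J / √S * (2 * x * y * z / (J * √S))) = S / (x * y * z) := by
  have h : J / √S * (2 * x * y * z / (J * √S)) = 2 * (x * y * z) / S := by
    rw [div_mul_div_comm, show √S * (J * √S) = J * (√S * √S) by ring,
      Real.mul_self_sqrt hS.le, mul_div_mul_left _ _ hJ]
    ring
  rw [h, div_div_eq_mul_div, mul_div_mul_left _ _ two_ne_zero]

/-- For a spherical triangle with side lengths `a, b, c` and `s x = sin (x/2)`,
`(1/3)·(1/s a + 1/s b + 1/s c)²·(sin((a+b+c)/2)/(s a + s b + s c)) ≥ 2/(tan r · tan R)`,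
with equality iff `a = b = c`; and the analogous statement for hyperbolic triangles
with `s x = sinh (x/2)`, `sinh` in place of `sin`, and `tanh` in place of `tan`. -/
theorem ineq3_right_spherical_and_hyperbolic :
    (∀ a b c : ℝ, 0 < a → 0 < b → 0 < c →
      a < b + c → b < a + c → c < a + b → a + b + c < 2 * Real.pi →
      (2 / (sphTanr a b c * sphTanR a b c) ≤
        (1 / 3) * (1 / Real.sin (a / 2) + 1 / Real.sin (b / 2) + 1 / Real.sin (c / 2)) ^ 2 *
          (Real.sin ((a + b + c) / 2) /
            (Real.sin (a / 2) + Real.sin (b / 2) + Real.sin (c / 2))) ∧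
      ((1 / 3) * (1 / Real.sin (a / 2) + 1 / Real.sin (b / 2) + 1 / Real.sin (c / 2)) ^ 2 *
          (Real.sin ((a + b + c) / 2) /
            (Real.sin (a / 2) + Real.sin (b / 2) + Real.sin (c / 2))) =
        2 / (sphTanr a b c * sphTanR a b c) ↔ a = b ∧ b = c))) ∧
    (∀ a b c : ℝ, 0 < a → 0 < b → 0 < c →
      a < b + c → b < a + c → c < a + b →
      (2 / (hypTanhr a b c * hypTanhR a b c) ≤
        (1 / 3) * (1 / Real.sinh (a / 2) + 1 / Real.sinh (b / 2) + 1 / Real.sinh (c / 2)) ^ 2 *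
          (Real.sinh ((a + b + c) / 2) /
            (Real.sinh (a / 2) + Real.sinh (b / 2) + Real.sinh (c / 2))) ∧
      ((1 / 3) * (1 / Real.sinh (a / 2) + 1 / Real.sinh (b / 2) + 1 / Real.sinh (c / 2)) ^ 2 *
          (Real.sinh ((a + b + c) / 2) /
            (Real.sinh (a / 2) + Real.sinh (b / 2) + Real.sinh (c / 2))) =
        2 / (hypTanhr a b c * hypTanhR a b c) ↔ a = b ∧ b = c))) := by
  refine ⟨fun a b c ha hb hc h₁ h₂ h₃ h₄ => ?_, fun a b c ha hb hc h₁ h₂ h₃ => ?_⟩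
  · have pos : ∀ t : ℝ, 0 < t → t < 2 * Real.pi → 0 < Real.sin (t / 2) := fun t h0 h1 =>
      Real.sin_pos_of_pos_of_lt_pi (by linarith) (by linarith)
    have inj : ∀ s t : ℝ, 0 < s → s < Real.pi → 0 < t → t < Real.pi →
        (Real.sin (s / 2) = Real.sin (t / 2) ↔ s = t) := fun s t hs hs' ht ht' =>
      ⟨fun h => by
        have := Real.injOn_sin ⟨by linarith, by linarith⟩ ⟨by linarith, by linarith⟩ h
        linarith, fun h => h ▸ rfl⟩
    have hJ : sphJ a b c ≠ 0 := (Real.sqrt_pos.2 (mul_pos (mul_pos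
      (pos _ (by linarith) (by linarith)) (pos _ (by linarith) (by linarith)))
      (pos _ (by linarith) (by linarith)))).ne'
    have hS := pos (a + b + c) (by linarith) h₄
    rw [sphTanr, sphTanR, two_div_div_sqrt_mul_div_mul_sqrt _ _ _ hJ hS,
      ← inj a b ha (by linarith) hb (by linarith), ← inj b c hb (by linarith) hc (by linarith)]
    exact div_mul_le_third_mul_sq_sum_inv (pos a ha (by linarith)) (pos b hb (by linarith))
      (pos c hc (by linarith)) hS
  · have pos : ∀ t : ℝ, 0 < t → 0 < Real.sinh (t / 2) := fun t h0 =>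
      Real.sinh_pos_iff.2 (half_pos h0)
    have inj : ∀ s t : ℝ, Real.sinh (s / 2) = Real.sinh (t / 2) ↔ s = t := fun s t => by
      rw [Real.sinh_inj, div_left_inj' two_ne_zero]
    have hJ : hypJ a b c ≠ 0 := (Real.sqrt_pos.2 (mul_pos (mul_pos
      (pos _ (by linarith)) (pos _ (by linarith))) (pos _ (by linarith)))).ne'
    have hS := pos (a + b + c) (by linarith)
    rw [hypTanhr, hypTanhR, two_div_div_sqrt_mul_div_mul_sqrt _ _ _ hJ hS, ← inj a b, ← inj b c]
    exact div_mul_le_third_mul_sq_sum_inv (pos a ha) (pos b hb) (pos c hc) hS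
end
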